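/- There exists an absolute constant C₀ such that the following holds. Let d be a positive integer, let G be a finite abelian group, let X ⊆ G with 0 ∈ X, and suppose that |kX| ≤ (k^d / 2^{2^{2^{7d+C₀}}})·|X| for some integer k ≥ 2, where kX is the k-fold iterated sumset of X. Then there is a proper symmetric coset-progression H + Q in G of rank r ≤ d and cardinality |H + Q| ≤ (2^{2^{2^{7d+C₀}}} / k^r)·|kX| such that X ⊆ H + Q. -/

import Mathlib

open Pointwise

/-- A generalized arithmetic progression (GAP) of rank `r` in an additive abelian group,
given by its generators and dimensions. -/
structure GAPData (G : Type*) [AddCommGroup G] (r : ℕ) where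
  g₀ : G
  g : Fin r → G
  N : Fin r → ℤ
  N' : Fin r → ℤ
  hle : ∀ i, N i ≤ N' i

namespace GAPData

variable {G : Type*} [AddCommGroup G] {r : ℕ}

/-- The set of elements of the GAP. -/
def toSet (P : GAPData G r) : Set G :=
  {x | ∃ m : Fin r → ℤ, (∀ i, P.N i ≤ m i ∧ m i ≤ P.N' i) ∧ x = P.g₀ + ∑ i, m i • P.g i}

/-- A GAP is proper if every element has a unique representation. -/
def IsProper (P : GAPData G r) : Prop :=
  ∀ m m' : Fin r → ℤ, (∀ i, P.N i ≤ m i ∧ m i ≤ P.N' i) →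
    (∀ i, P.N i ≤ m' i ∧ m' i ≤ P.N' i) →
    P.g₀ + ∑ i, m i • P.g i = P.g₀ + ∑ i, m' i • P.g i → m = m'

/-- A GAP is symmetric if `g₀ = 0` and `N i = -N' i` for all `i`. -/
def IsSymmetric (P : GAPData G r) : Prop :=
  P.g₀ = 0 ∧ ∀ i, P.N i = -P.N' i

/-- The `t`-fold dilate `P_t` of a GAP, whose dimensions are multiplied by `t`. -/
def dilate (P : GAPData G r) (t : ℕ) : GAPData G r where
  g₀ := P.g₀
  g := P.g
  N := fun i => (t : ℤ) * P.N i
  N' := fun i => (t : ℤ) * P.N' i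
  hle := fun i => mul_le_mul_of_nonneg_left (P.hle i) (Int.natCast_nonneg t)

end GAPData

/-- `H + P` is a proper coset-progression: `H` is a finite subgroup, `P` is a proper GAP and
`|H + P| = |H| * |P|`. -/
def IsProperCosetProg {G : Type*} [AddCommGroup G] {r : ℕ}
    (H : AddSubgroup G) (P : GAPData G r) : Prop :=
  (H : Set G).Finite ∧ P.IsProper ∧
    ((H : Set G) + P.toSet).ncard = (H : Set G).ncard * P.toSet.ncard

/-- A symmetric coset-progression `H + P` is `t`-proper if `H + P_t` is proper. -/
def IsTProperCosetProg {G : Type*} [AddCommGroup G] (t : ℕ) {r : ℕ}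
    (H : AddSubgroup G) (P : GAPData G r) : Prop :=
  IsProperCosetProg H (P.dilate t)

/-- The `k`-fold iterated sumset `kX = X + ⋯ + X`. -/
def iterSumset {G : Type*} [AddCommGroup G] : ℕ → Set G → Set G
  | 0, _ => {0}
  | k + 1, X => X + iterSumset k X

theorem exists_reduced_basis (n : ℕ) :
    ∀ (E : Type) [NormedAddCommGroup E] [NormedSpace ℝ E] [FiniteDimensional ℝ E],
      Module.finrank ℝ E = n → ∀ L : AddSubgroup E,
        (∀ R : ℝ, {x : E | x ∈ L ∧ ‖x‖ ≤ R}.Finite) →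
        ∃ (r : ℕ) (v : Fin r → E), (∀ i, v i ∈ L) ∧
          (∀ m : Fin r → ℤ, ∑ i, m i • v i = 0 → m = 0) ∧
          ∀ x ∈ L, ∃ m : Fin r → ℤ, x = ∑ i, m i • v i ∧
            ∀ i, |(m i : ℝ)| * ‖v i‖ ≤ (3 * r + 1 : ℝ) ^ r * ‖x‖ := by
  induction n with
  | zero =>
    intro E _ _ _ hE L _
    have := Module.finrank_zero_iff.mp hE
    refine ⟨0, Fin.elim0, fun i => i.elim0, fun m _ => Subsingleton.elim _ _, fun x _ => ?_⟩
    exact ⟨Fin.elim0, Subsingleton.elim _ _, fun i => i.elim0⟩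
  | succ n ih =>
    intro E _ _ _ hE L hL
    by_cases hbot : ∀ x ∈ L, x = 0
    · refine ⟨0, Fin.elim0, fun i => i.elim0, fun m _ => Subsingleton.elim _ _, fun x hx => ?_⟩
      exact ⟨Fin.elim0, by simp [hbot x hx], fun i => i.elim0⟩
    push Not at hbot
    obtain ⟨y, hyL, hy0⟩ := hbot
    obtain ⟨u, ⟨⟨huL, hu1⟩, hu0⟩, humin'⟩ :=
      Set.exists_min_image ({x : E | x ∈ L ∧ ‖x‖ ≤ ‖y‖} \ {0}) (fun x => ‖x‖)
        ((hL ‖y‖).sdiff) ⟨y, ⟨hyL, le_rfl⟩, hy0⟩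
    have hu0 : u ≠ 0 := hu0
    have hupos : 0 < ‖u‖ := norm_pos_iff.mpr hu0
    have humin : ∀ x ∈ L, x ≠ 0 → ‖u‖ ≤ ‖x‖ := by
      intro x hx hx0
      rcases le_total ‖x‖ ‖y‖ with h | h
      · exact humin' x ⟨⟨hx, h⟩, hx0⟩
      · exact hu1.trans h
    -- real multiples of `u` lying in `L` are integer multiples
    have hmult : ∀ t : ℝ, t • u ∈ L → ∃ k : ℤ, t • u = k • u := by
      intro t ht
      refine ⟨round t, ?_⟩
      by_contra hne
      have h1 : t • u - round t • u ∈ L := L.sub_mem ht (L.zsmul_mem huL _)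
      have h2 := humin _ h1 (sub_ne_zero.mpr hne)
      rw [← Int.cast_smul_eq_zsmul ℝ, ← sub_smul, norm_smul, Real.norm_eq_abs] at h2
      have h3 := abs_sub_round t
      nlinarith
    obtain ⟨S, hSu⟩ : ∃ S : Submodule ℝ E, S = Submodule.span ℝ {u} := ⟨_, rfl⟩
    have hmemS : ∀ x, x ∈ S ↔ ∃ t : ℝ, t • u = x := by
      intro x; rw [hSu]; exact Submodule.mem_span_singleton
    have : IsClosed (S : Set E) := Submodule.closed_of_finiteDimensional S
    have hQu : S.mkQ u = 0 := by
      rw [Submodule.mkQ_apply, Submodule.Quotient.mk_eq_zero, hmemS]; exact ⟨1, one_smul _ _⟩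
    have hlift : ∀ x ∈ L, ∀ η : ℝ, 0 < η → ∃ w ∈ L, S.mkQ w = S.mkQ x ∧
        ‖w‖ ≤ ‖S.mkQ x‖ + η + ‖u‖ / 2 := by
      intro x hx η hη
      obtain ⟨z, hz, hzn⟩ := Submodule.Quotient.norm_mk_lt (S := S) (S.mkQ x) hη
      have hz' : z - x ∈ S := (Submodule.Quotient.eq S).mp hz
      obtain ⟨t, ht⟩ := (hmemS _).mp hz'
      have hzx : z = x + t • u := by rw [ht]; abel
      refine ⟨x + round t • u, L.add_mem hx (L.zsmul_mem huL _), ?_, ?_⟩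
      · rw [map_add, map_zsmul]
        rw [hQu, smul_zero, add_zero]
      · have h3 := abs_sub_round t
        have : x + round t • u = z + ((round t : ℝ) - t) • u := by
          rw [hzx, sub_smul, Int.cast_smul_eq_zsmul]; abel
        rw [this]
        refine (norm_add_le _ _).trans ?_
        rw [norm_smul, Real.norm_eq_abs, abs_sub_comm]
        nlinarith
    have hS : Module.finrank ℝ (E ⧸ S) = n := by
      have h1 := Submodule.finrank_quotient_add_finrank S
      have h2 : Module.finrank ℝ S = 1 := by rw [hSu]; exact finrank_span_singleton hu0
      omega
    have hfin : ∀ R : ℝ, {x : E ⧸ S | x ∈ L.map (S.mkQ : E →+ E ⧸ S) ∧ ‖x‖ ≤ R}.Finite := by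
      intro R
      refine ((hL (R + 1 + ‖u‖ / 2)).image S.mkQ).subset ?_
      rintro _ ⟨⟨x, hx, rfl⟩, hxR⟩
      obtain ⟨w, hw, hwx, hwn⟩ := hlift x hx 1 one_pos
      refine ⟨w, ⟨hw, hwn.trans ?_⟩, hwx⟩
      have : ‖S.mkQ x‖ ≤ R := hxR
      linarith
    obtain ⟨r, v, hvL, hvi, hvc⟩ := ih (E ⧸ S) hS (L.map (S.mkQ : E →+ E ⧸ S)) hfin
    have hwex : ∀ i, ∃ w ∈ L, S.mkQ w = v i ∧ ‖w‖ ≤ 3 * ‖v i‖ := by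
      intro i
      obtain ⟨x, hx, hxv⟩ := hvL i
      have hxv : S.mkQ x = v i := hxv
      have hv0 : v i ≠ 0 := by
        intro h0
        have := hvi (Pi.single i 1) (by simp [Pi.single_apply, h0])
        have := congrFun this i
        simp at this
      have hvpos : 0 < ‖v i‖ := norm_pos_iff.mpr hv0
      have hhalf : ‖u‖ / 2 ≤ ‖v i‖ := by
        refine le_of_forall_pos_le_add fun η hη => ?_
        obtain ⟨w, hw, hwx, hwn⟩ := hlift x hx η hη
        have : w ≠ 0 := by
          rintro rfl
          rw [map_zero, hxv] at hwx
          exact hv0 hwx.symm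
        have := humin w hw this
        rw [hxv] at hwn
        linarith
      obtain ⟨w, hw, hwx, hwn⟩ := hlift x hx ‖v i‖ hvpos
      refine ⟨w, hw, hwx.trans hxv, ?_⟩
      rw [hxv] at hwn
      linarith
    choose w hwL hwv hwn using hwex
    have hmap : ∀ m : Fin r → ℤ, S.mkQ (∑ i, m i • w i) = ∑ i, m i • v i := by
      intro m
      simp only [map_sum, map_zsmul, hwv]
    refine ⟨r + 1, Fin.cons u w, ?_, ?_, ?_⟩
    · intro i
      refine Fin.cases ?_ (fun j => ?_) i
      · simpa using huL
      · simpa using hwL j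
    · intro m hm
      rw [Fin.sum_univ_succ] at hm
      simp only [Fin.cons_zero, Fin.cons_succ] at hm
      have h1 := congrArg S.mkQ hm
      rw [map_add, map_zsmul, hQu, smul_zero, zero_add, hmap (fun i => m i.succ), map_zero] at h1
      have h2 := hvi _ h1
      have h3 : ∀ i : Fin r, m i.succ = 0 := fun i => congrFun h2 i
      simp only [h3, zero_smul, Finset.sum_const_zero, add_zero] at hm
      have h4 : m 0 = 0 := by
        rw [← Int.cast_smul_eq_zsmul ℝ] at hm
        simpa [hu0] using hm
      funext i
      exact Fin.cases h4 h3 i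
    · intro x hx
      obtain ⟨m, hm, hmn⟩ := hvc (S.mkQ x) ⟨x, hx, rfl⟩
      have hdiff : x - ∑ i, m i • w i ∈ S := by
        rw [← Submodule.Quotient.mk_eq_zero, ← Submodule.mkQ_apply, map_sub, hmap, hm, sub_self]
      obtain ⟨t, ht⟩ := (hmemS _).mp hdiff
      obtain ⟨k, hk⟩ := hmult t (by
        rw [ht]; exact L.sub_mem hx (L.sum_mem fun i _ => L.zsmul_mem (hwL i) _))
      have hQ : ‖S.mkQ x‖ ≤ ‖x‖ := Submodule.Quotient.norm_mk_le S x
      set c : ℝ := (3 * r + 1 : ℝ) ^ r with hc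
      have hc1 : 1 ≤ c := one_le_pow₀ (by linarith [(Nat.cast_nonneg r : (0 : ℝ) ≤ r)])
      have hcbig : (3 * r + 3) * c + 1 ≤ (3 * ((r + 1 : ℕ) : ℝ) + 1) ^ (r + 1) := by
        have h1 : c ≤ (3 * ((r + 1 : ℕ) : ℝ) + 1) ^ r := by
          push_cast; rw [hc]; gcongr; linarith
        rw [pow_succ]
        have h2 : (3 * ((r + 1 : ℕ) : ℝ) + 1) = 3 * r + 4 := by push_cast; ring
        have h4 : (0 : ℝ) ≤ r := Nat.cast_nonneg r
        calc (3 * r + 3) * c + 1 ≤ c * (3 * r + 4) := by nlinarith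
          _ ≤ _ := by rw [h2] at h1 ⊢; gcongr
      have hxn := norm_nonneg x
      have hwi : ∀ i, |(m i : ℝ)| * ‖w i‖ ≤ 3 * c * ‖x‖ := by
        intro i
        have h1 := hmn i
        have h2 := hwn i
        calc |(m i : ℝ)| * ‖w i‖ ≤ |(m i : ℝ)| * (3 * ‖v i‖) := by gcongr
          _ = 3 * (|(m i : ℝ)| * ‖v i‖) := by ring
          _ ≤ 3 * (c * ‖S.mkQ x‖) := by gcongr
          _ ≤ 3 * (c * ‖x‖) := by gcongr
          _ = _ := by ring
      have hr : (0 : ℝ) ≤ r := Nat.cast_nonneg r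
      refine ⟨Fin.cons k m, ?_, ?_⟩
      · rw [Fin.sum_univ_succ]
        simp only [Fin.cons_zero, Fin.cons_succ]
        rw [← hk, ht]; abel
      · intro i
        refine Fin.cases ?_ (fun j => ?_) i
        · simp only [Fin.cons_zero]
          have h1 : |(k : ℝ)| * ‖u‖ = ‖x - ∑ i, m i • w i‖ := by
            rw [← ht, hk, ← Int.cast_smul_eq_zsmul ℝ, norm_smul, Real.norm_eq_abs]
          have h2 : ‖∑ i, m i • w i‖ ≤ r * (3 * c * ‖x‖) := by
            refine (norm_sum_le _ _).trans ?_
            refine (Finset.sum_le_card_nsmul _ _ (3 * c * ‖x‖) fun i _ => ?_).trans ?_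
            · rw [← Int.cast_smul_eq_zsmul ℝ, norm_smul, Real.norm_eq_abs]
              exact hwi i
            · simp
          rw [h1]
          calc ‖x - ∑ i, m i • w i‖ ≤ ‖x‖ + r * (3 * c * ‖x‖) :=
                (norm_sub_le _ _).trans (by gcongr)
            _ = (3 * r * c + 1) * ‖x‖ := by ring
            _ ≤ ((3 * r + 3) * c + 1) * ‖x‖ := by gcongr; linarith
            _ ≤ _ := by gcongr
        · simp only [Fin.cons_succ]
          calc |(m j : ℝ)| * ‖w j‖ ≤ 3 * c * ‖x‖ := hwi j
            _ ≤ ((3 * r + 3) * c + 1) * ‖x‖ := by gcongr; nlinarith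
            _ ≤ _ := by gcongr

section LiftRelation

variable {G V : Type} [AddCommGroup G] [NormedAddCommGroup V]

/-- The kernel `{x | (x, 0) ∈ R}` of an additive relation. -/
def relKernel (R : AddSubgroup (G × V)) : AddSubgroup G :=
  R.comap (AddMonoidHom.inl G V)

theorem mem_relKernel {R : AddSubgroup (G × V)} {x : G} : x ∈ relKernel R ↔ (x, (0 : V)) ∈ R :=
  Iff.rfl

theorem ncard_relFibre [Finite G] {R : AddSubgroup (G × V)} {δ : ℝ}
    (hsep : ∀ v : V, ((0 : G), v) ∈ R → ‖v‖ < δ → v = 0) (S : Finset V)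
    (hS : ∀ v ∈ S, ∃ x : G, (x, v) ∈ R) (hd : ∀ v ∈ S, ∀ v' ∈ S, ‖v - v'‖ < δ) :
    {x : G | ∃ v ∈ S, (x, v) ∈ R}.ncard = (relKernel R : Set G).ncard * S.card := by
  choose! s hs using hS
  have key : Set.BijOn (fun p : G × V => p.1 + s p.2)
      ((relKernel R : Set G) ×ˢ (S : Set V)) {x : G | ∃ v ∈ S, (x, v) ∈ R} := by
    refine ⟨?_, ?_, ?_⟩
    · rintro ⟨h, v⟩ ⟨hh, hv⟩
      refine ⟨v, hv, ?_⟩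
      simpa using R.add_mem (mem_relKernel.1 hh) (hs v hv)
    · rintro ⟨h, v⟩ ⟨hh, hv⟩ ⟨h', v'⟩ ⟨hh', hv'⟩ heq
      simp only [SetLike.mem_coe, mem_relKernel] at hh hh'
      have h1 := R.sub_mem (R.add_mem hh (hs v hv)) (R.add_mem hh' (hs v' hv'))
      simp only at heq
      simp only [Prod.mk_add_mk, Prod.mk_sub_mk, heq, sub_self, zero_add] at h1
      have h2 : v = v' := sub_eq_zero.1 (hsep _ h1 (hd v hv v' hv'))
      subst h2
      simpa using heq
    · rintro x ⟨v, hv, hx⟩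
      refine ⟨(x - s v, v), ⟨?_, hv⟩, by simp⟩
      have h1 := R.sub_mem hx (hs v hv)
      simpa [mem_relKernel] using h1
  rw [← key.image_eq, key.injOn.ncard_image, Set.ncard_prod, Set.ncard_coe_finset]

end LiftRelation

theorem card_mul_card_le_of_closure {V : Type} [NormedAddCommGroup V] {r : ℕ} {v : Fin r → V}
    {L : AddSubgroup V} {ρ : ℝ}
    (hv : ∀ i, v i ∈ AddSubgroup.closure {x | x ∈ L ∧ ‖x‖ ≤ ρ})
    (hind : ∀ m : Fin r → ℤ, ∑ i, m i • v i = 0 → m = 0)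
    (hspan : ∀ x ∈ AddSubgroup.closure {x | x ∈ L ∧ ‖x‖ ≤ ρ}, ∃ m : Fin r → ℤ, x = ∑ i, m i • v i)
    (S S' : Finset V) (hS : ∀ x, x ∈ S ↔ x ∈ L ∧ ‖x‖ ≤ ρ)
    (hS' : ∀ x, x ∈ S' ↔ x ∈ L ∧ ‖x‖ ≤ 3 * ρ) : r * S.card ≤ S'.card := by
  classical
  choose! c hc using hspan
  have huniq : ∀ m m' : Fin r → ℤ, ∑ i, m i • v i = ∑ i, m' i • v i → m = m' := by
    intro m m' h
    refine sub_eq_zero.1 (hind (m - m') ?_)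
    simp [sub_smul, Finset.sum_sub_distrib, h]
  have hcS : ∀ x ∈ S, x ∈ AddSubgroup.closure {x | x ∈ L ∧ ‖x‖ ≤ ρ} :=
    fun x hx => AddSubgroup.subset_closure ((hS x).1 hx)
  let red : V → Fin r → ZMod 2 := fun x i => (c x i : ZMod 2)
  have hspan' : ∀ x ∈ AddSubgroup.closure {x | x ∈ L ∧ ‖x‖ ≤ ρ},
      red x ∈ Submodule.span (ZMod 2) (S.image red : Set (Fin r → ZMod 2)) := by
    intro x hx
    induction hx using AddSubgroup.closure_induction with
    | mem x hx =>
      exact Submodule.subset_span (by simpa using ⟨x, (hS x).2 hx, rfl⟩)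
    | zero =>
      have : c 0 = 0 := hind _ (hc 0 (AddSubgroup.zero_mem _)).symm
      have h0 : red 0 = 0 := by funext i; simp [red, this]
      rw [h0]; exact Submodule.zero_mem _
    | add x y hx hy ihx ihy =>
      have : c (x + y) = c x + c y := by
        apply huniq
        rw [← hc _ (AddSubgroup.add_mem _ hx hy)]
        simp only [Pi.add_apply, add_smul, Finset.sum_add_distrib]
        rw [← hc x hx, ← hc y hy]
      have h0 : red (x + y) = red x + red y := by funext i; simp [red, this]
      rw [h0]; exact Submodule.add_mem _ ihx ihy
    | neg x hx ih =>
      have : c (-x) = - c x := by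
        apply huniq
        rw [← hc _ (AddSubgroup.neg_mem _ hx)]
        simp only [Pi.neg_apply, neg_smul, Finset.sum_neg_distrib]
        rw [← hc x hx]
      have h0 : red (-x) = - red x := by funext i; simp [red, this]
      rw [h0]; exact Submodule.neg_mem _ ih
  have htop : Submodule.span (ZMod 2) (S.image red : Set (Fin r → ZMod 2)) = ⊤ := by
    rw [eq_top_iff, ← (Pi.basisFun (ZMod 2) (Fin r)).span_eq, Submodule.span_le]
    rintro _ ⟨i, rfl⟩
    have h1 : c (v i) = Pi.single i 1 := by
      apply huniq
      rw [← hc _ (hv i)]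
      simp [Pi.single_apply]
    have h2 : red (v i) = Pi.basisFun (ZMod 2) (Fin r) i := by
      funext j
      simp [red, h1, Pi.single_apply]
    rw [← h2]
    exact hspan' _ (hv i)
  have hr : r ≤ (S.image red).card := by
    have := finrank_span_finset_le_card (R := ZMod 2) (S.image red)
    rw [Set.finrank, htop, finrank_top] at this
    simpa using this
  have hrep : ∀ t ∈ S.image red, ∃ x ∈ S, red x = t := by
    intro t ht; simpa using ht
  choose! u hu hut using hrep
  have hle : ((S.image red) ×ˢ S).card ≤ S'.card := by
    apply Finset.card_le_card_of_injOn (fun p => u p.1 + 2 • p.2)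
    · rintro ⟨t, y⟩ hp
      simp only [Finset.coe_product, Set.mem_prod, Finset.mem_coe] at hp
      obtain ⟨h1, h2⟩ := (hS _).1 (hu t hp.1)
      obtain ⟨h3, h4⟩ := (hS _).1 hp.2
      refine (hS' _).2 ⟨L.add_mem h1 (L.nsmul_mem h3 2), ?_⟩
      calc ‖u t + 2 • y‖ ≤ ‖u t‖ + ‖2 • y‖ := norm_add_le _ _
        _ ≤ ‖u t‖ + 2 * ‖y‖ := by
          gcongr; simpa using norm_nsmul_le (n := 2) (a := y)
        _ ≤ 3 * ρ := by linarith
    · rintro ⟨t, y⟩ hp ⟨t', y'⟩ hp' heq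
      simp only [Finset.coe_product, Set.mem_prod, Finset.mem_coe] at hp hp'
      simp only at heq
      have h1 : c (u t) + 2 • c y = c (u t') + 2 • c y' := by
        apply huniq
        simp only [Pi.add_apply, Pi.smul_apply, add_smul, smul_assoc, Finset.sum_add_distrib,
          ← Finset.smul_sum]
        rw [← hc _ (hcS _ (hu t hp.1)), ← hc _ (hcS _ (hu t' hp'.1)), ← hc _ (hcS _ hp.2),
          ← hc _ (hcS _ hp'.2), heq]
      have h2 : t = t' := by
        rw [← hut t hp.1, ← hut t' hp'.1]
        funext i
        have h3 := congrArg (fun z : ℤ => (z : ZMod 2)) (congrFun h1 i)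
        have h4 : (2 : ZMod 2) = 0 := by decide
        simpa [h4] using h3
      subst h2
      have h3 : c y = c y' := by
        funext i
        have := congrFun h1 i
        simpa using this
      rw [hc _ (hcS _ hp.2), hc _ (hcS _ hp'.2), h3]
  rw [Finset.card_product] at hle
  exact (Nat.mul_le_mul_right _ hr).trans hle

theorem exists_adapted_box {V : Type} [NormedAddCommGroup V] {r₀ : ℕ} {v : Fin r₀ → V}
    {L : AddSubgroup V} {C ε : ℝ} (hε : 0 < C * ε) (hC : 0 ≤ C)
    (hind : ∀ m : Fin r₀ → ℤ, ∑ i, m i • v i = 0 → m = 0)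
    (hcoord : ∀ x ∈ L, ∃ m : Fin r₀ → ℤ, x = ∑ i, m i • v i ∧
      ∀ i, |(m i : ℝ)| * ‖v i‖ ≤ C * ‖x‖) :
    ∃ (r : ℕ) (e : Fin r → Fin r₀) (N : Fin r → ℕ), r ≤ r₀ ∧
      (∀ m : Fin r → ℤ, ∑ i, m i • v (e i) = 0 → m = 0) ∧ (∀ i, 1 ≤ N i) ∧
      (∀ i, N i * ‖v (e i)‖ ≤ C * ε) ∧
      ∀ x ∈ L, ‖x‖ ≤ ε → ∃ m : Fin r → ℤ, x = ∑ i, m i • v (e i) ∧ ∀ i, |m i| ≤ N i := by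
  classical
  let I : Finset (Fin r₀) := {i | ‖v i‖ ≤ C * ε}
  have hlin : LinearIndependent ℤ v := by
    rw [Fintype.linearIndependent_iff]
    intro g hg i
    exact congrFun (hind g hg) i
  have hpos : ∀ i, 0 < ‖v i‖ := fun i => norm_pos_iff.2 (hlin.ne_zero i)
  refine ⟨I.card, I.orderEmbOfFin rfl, fun i => ⌊C * ε / ‖v (I.orderEmbOfFin rfl i)‖⌋₊,
    ?_, ?_, ?_, ?_, ?_⟩
  · simpa using I.card_le_univ
  · have h1 := hlin.comp (I.orderEmbOfFin rfl) (I.orderEmbOfFin rfl).injective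
    rw [Fintype.linearIndependent_iff] at h1
    intro m hm
    funext i
    exact h1 m hm i
  · intro i
    have hi : I.orderEmbOfFin rfl i ∈ I := I.orderEmbOfFin_mem rfl i
    simp only [I, Finset.mem_filter, Finset.mem_univ, true_and] at hi
    rw [Nat.one_le_floor_iff, le_div_iff₀ (hpos _), one_mul]
    exact hi
  · intro i
    rw [← le_div_iff₀ (hpos _)]
    exact Nat.floor_le (div_nonneg hε.le (norm_nonneg _))
  · intro x hx hxε
    obtain ⟨m, hm, hmb⟩ := hcoord x hx
    have hmb' : ∀ i, |(m i : ℝ)| * ‖v i‖ ≤ C * ε :=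
      fun i => (hmb i).trans (mul_le_mul_of_nonneg_left hxε hC)
    refine ⟨fun i => m (I.orderEmbOfFin rfl i), ?_, ?_⟩
    · have h1 : ∑ i, m i • v i = ∑ i ∈ I, m i • v i := by
        symm
        apply Finset.sum_subset (Finset.subset_univ I)
        intro i _ hi
        simp only [I, Finset.mem_filter, Finset.mem_univ, true_and, not_le] at hi
        have h2 : m i = 0 := by
          by_contra h
          have h3 : (1 : ℝ) ≤ |(m i : ℝ)| := by exact_mod_cast Int.one_le_abs h
          nlinarith [hmb' i, hpos i]
        simp [h2]
      rw [hm, h1]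
      have h4 : I = Finset.univ.map (I.orderEmbOfFin rfl).toEmbedding := by
        ext i
        have := I.range_orderEmbOfFin rfl
        rw [← Finset.mem_coe, ← this]
        simp
      conv_lhs => rw [h4]
      rw [Finset.sum_map]
      rfl
    · intro i
      have h5 : |(m (I.orderEmbOfFin rfl i) : ℝ)| ≤ C * ε / ‖v (I.orderEmbOfFin rfl i)‖ := by
        rw [le_div_iff₀ (hpos _)]
        exact hmb' _
      have h6 : ((|m (I.orderEmbOfFin rfl i)|.toNat : ℕ) : ℝ) ≤
          C * ε / ‖v (I.orderEmbOfFin rfl i)‖ := by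
        have : ((|m (I.orderEmbOfFin rfl i)|.toNat : ℕ) : ℤ) = |m (I.orderEmbOfFin rfl i)| :=
          Int.toNat_of_nonneg (abs_nonneg _)
        have h7 : ((|m (I.orderEmbOfFin rfl i)|.toNat : ℕ) : ℝ) =
            |(m (I.orderEmbOfFin rfl i) : ℝ)| := by
          exact_mod_cast congrArg (fun z : ℤ => (z : ℝ)) this
        rw [h7]; exact h5
      have h8 := Nat.le_floor h6
      have : ((|m (I.orderEmbOfFin rfl i)|.toNat : ℕ) : ℤ) = |m (I.orderEmbOfFin rfl i)| :=
        Int.toNat_of_nonneg (abs_nonneg _)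
      beta_reduce
      omega

theorem rank_le_of_relation {G V : Type} [AddCommGroup G] [Finite G] [NormedAddCommGroup V]
    {R : AddSubgroup (G × V)} (hsep : ∀ v : V, ((0 : G), v) ∈ R → ‖v‖ < 18 → v = 0)
    (hfin : ∀ ρ : ℝ, {v : V | v ∈ R.map (AddMonoidHom.snd G V) ∧ ‖v‖ ≤ ρ}.Finite)
    {r : ℕ} {v : Fin r → V}
    (hv : ∀ i, v i ∈ AddSubgroup.closure {x | x ∈ R.map (AddMonoidHom.snd G V) ∧ ‖x‖ ≤ 1})
    (hind : ∀ m : Fin r → ℤ, ∑ i, m i • v i = 0 → m = 0)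
    (hspan : ∀ x ∈ AddSubgroup.closure {x | x ∈ R.map (AddMonoidHom.snd G V) ∧ ‖x‖ ≤ 1},
      ∃ m : Fin r → ℤ, x = ∑ i, m i • v i) {κ : ℕ}
    (hκ : {x : G | ∃ v, (x, v) ∈ R ∧ ‖v‖ ≤ 3}.ncard ≤
      κ * {x : G | ∃ v, (x, v) ∈ R ∧ ‖v‖ ≤ 1}.ncard) : r ≤ κ := by
  have hcard : ∀ ρ : ℝ, 2 * ρ < 18 → {x : G | ∃ v, (x, v) ∈ R ∧ ‖v‖ ≤ ρ}.ncard =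
      (relKernel R : Set G).ncard * (hfin ρ).toFinset.card := by
    intro ρ hρ
    rw [← ncard_relFibre hsep (hfin ρ).toFinset]
    · congr 1
      ext x
      constructor
      · rintro ⟨v, h1, h2⟩
        exact ⟨v, by simpa using ⟨⟨x, h1⟩, h2⟩, h1⟩
      · rintro ⟨v, h1, h2⟩
        simp only [Set.Finite.mem_toFinset] at h1
        exact ⟨v, h2, h1.2⟩
    · intro v hv
      simpa using ((Set.Finite.mem_toFinset _).1 hv).1
    · intro v hv v' hv'
      have h1 := ((Set.Finite.mem_toFinset _).1 hv).2
      have h2 := ((Set.Finite.mem_toFinset _).1 hv').2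
      have := norm_sub_le v v'
      linarith
  have h := card_mul_card_le_of_closure hv hind hspan (hfin 1).toFinset (hfin (3 * 1)).toFinset
    (by simp) (by simp)
  rw [hcard 3 (by norm_num), hcard 1 (by norm_num)] at hκ
  rw [mul_one] at h
  have hH : 0 < (relKernel R : Set G).ncard :=
    (Set.ncard_pos (Set.toFinite _)).2 ⟨0, (relKernel R).zero_mem⟩
  have hS : 0 < (hfin 1).toFinset.card := Finset.card_pos.2 ⟨0, by simpa using ⟨0, R.zero_mem⟩⟩
  refine Nat.le_of_mul_le_mul_right (c := (relKernel R : Set G).ncard * (hfin 1).toFinset.card)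
    ?_ (Nat.mul_pos hH hS)
  calc r * ((relKernel R : Set G).ncard * (hfin 1).toFinset.card)
      = (relKernel R : Set G).ncard * (r * (hfin 1).toFinset.card) := by ring
    _ ≤ (relKernel R : Set G).ncard * (hfin 3).toFinset.card := Nat.mul_le_mul_left _ h
    _ ≤ _ := hκ

theorem exists_small_lift {G V : Type} [AddCommGroup G] [NormedAddCommGroup V] [NormedSpace ℝ V]
    {R : AddSubgroup (G × V)} (hsep : ∀ v : V, ((0 : G), v) ∈ R → ‖v‖ < 18 → v = 0)
    {x : G} {w : ℕ} (hw : 1 ≤ w) (h : ∀ n ≤ w, ∃ v : V, (n • x, v) ∈ R ∧ ‖v‖ ≤ 1) :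
    ∃ v : V, (x, v) ∈ R ∧ ‖v‖ ≤ 1 / w := by
  choose! f hf hf1 using h
  have hx : (x, f 1) ∈ R := by simpa using hf 1 hw
  have key : ∀ n ≤ w, f n = n • f 1 := by
    intro n
    induction n with
    | zero =>
      intro h0
      have h1 := hf 0 h0
      rw [zero_smul] at h1 ⊢
      exact hsep _ h1 (lt_of_le_of_lt (hf1 0 h0) (by norm_num))
    | succ n ih =>
      intro hn
      have hn' : n ≤ w := by omega
      have h1 := R.sub_mem (R.add_mem (hf n hn') hx) (hf (n + 1) hn)
      have h2 : f n + f 1 - f (n + 1) = 0 := by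
        apply hsep
        · convert h1 using 1
          simp [succ_nsmul]
        · have a1 := norm_sub_le (f n + f 1) (f (n + 1))
          have a2 := norm_add_le (f n) (f 1)
          have := hf1 n hn'
          have := hf1 1 hw
          have := hf1 (n + 1) hn
          linarith
      rw [succ_nsmul, ← ih hn', sub_eq_zero.1 h2]
  refine ⟨f 1, hx, ?_⟩
  have h1 := hf1 w le_rfl
  rw [key w le_rfl, ← Nat.cast_smul_eq_nsmul ℝ, norm_smul, Real.norm_natCast] at h1
  rw [le_div_iff₀ (by exact_mod_cast hw)]
  linarith

theorem norm_sum_zsmul_le {V : Type} [NormedAddCommGroup V] [NormedSpace ℝ V] {r : ℕ}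
    (v : Fin r → V) (m : Fin r → ℤ) {c : ℝ} (h : ∀ i, |(m i : ℝ)| * ‖v i‖ ≤ c) :
    ‖∑ i, m i • v i‖ ≤ r * c := by
  calc ‖∑ i, m i • v i‖ ≤ ∑ i : Fin r, c := by
        refine norm_sum_le_of_le _ fun i _ => ?_
        rw [← Int.cast_smul_eq_zsmul ℝ, norm_smul, Real.norm_eq_abs]
        exact h i
    _ = r * c := by simp

theorem card_pi_Icc (r : ℕ) (N : Fin r → ℕ) :
    (Fintype.piFinset fun i => Finset.Icc (-(N i : ℤ)) (N i)).card = ∏ i, (2 * N i + 1) := by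
  rw [Fintype.card_piFinset]
  refine Finset.prod_congr rfl fun i _ => ?_
  rw [Int.card_Icc]
  omega

theorem sum_zsmul_mem_relation {G V : Type} [AddCommGroup G] [AddCommGroup V]
    {R : AddSubgroup (G × V)} {r : ℕ} {u : Fin r → G} {b : Fin r → V}
    (h : ∀ i, (u i, b i) ∈ R) (m : Fin r → ℤ) :
    (∑ i, m i • u i, ∑ i, m i • b i) ∈ R := by
  have h1 : ∑ i, m i • (u i, b i) ∈ R := R.sum_mem fun i _ => R.zsmul_mem (h i) _
  convert h1 using 1
  ext <;> simp [Prod.fst_sum, Prod.snd_sum]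

theorem eq_zero_of_sum_zsmul_mem_relKernel {G V : Type} [AddCommGroup G]
    [NormedAddCommGroup V] [NormedSpace ℝ V]
    {R : AddSubgroup (G × V)} {δ : ℝ} (hsep : ∀ v : V, ((0 : G), v) ∈ R → ‖v‖ < δ → v = 0)
    {r : ℕ} {u : Fin r → G} {b : Fin r → V} (hu : ∀ i, (u i, b i) ∈ R)
    (hind : ∀ m : Fin r → ℤ, ∑ i, m i • b i = 0 → m = 0) {m : Fin r → ℤ} {c : ℝ}
    (hc : r * c < δ) (hm : ∀ i, |(m i : ℝ)| * ‖b i‖ ≤ c)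
    (h : ∑ i, m i • u i ∈ relKernel R) : m = 0 := by
  apply hind
  apply hsep
  · have h1 := R.sub_mem (sum_zsmul_mem_relation hu m) (mem_relKernel.1 h)
    simpa using h1
  · exact (norm_sum_zsmul_le b m hm).trans_lt hc

theorem exists_cosetProg_of_box {G V : Type} [AddCommGroup G] [Fintype G]
    [NormedAddCommGroup V] [NormedSpace ℝ V]
    {R : AddSubgroup (G × V)} (hsep : ∀ v : V, ((0 : G), v) ∈ R → ‖v‖ < 18 → v = 0)
    {r : ℕ} {u : Fin r → G} {b : Fin r → V} {N : Fin r → ℕ} (hu : ∀ i, (u i, b i) ∈ R)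
    (hind : ∀ m : Fin r → ℤ, ∑ i, m i • b i = 0 → m = 0) (hN : ∀ i, 1 ≤ N i) {c : ℝ}
    (hb : ∀ i, N i * ‖b i‖ ≤ c) {q : ℕ} (hq : 1 ≤ q) (hc0 : 0 ≤ c) (hqc : r * (q * c) ≤ 1)
    {X : Set G}
    (hX : ∀ x ∈ X, ∃ m : Fin r → ℤ, (x, ∑ i, m i • b i) ∈ R ∧ ∀ i, |m i| ≤ N i) :
    ∃ Q : GAPData G r, Q.IsSymmetric ∧ IsProperCosetProg (relKernel R) Q ∧
      X ⊆ (relKernel R : Set G) + Q.toSet ∧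
      q ^ r * ((relKernel R : Set G) + Q.toSet).ncard ≤
        2 ^ r * {x : G | ∃ v, (x, v) ∈ R ∧ ‖v‖ ≤ 1}.ncard := by
  classical
  have hq' : (1 : ℝ) ≤ q := by exact_mod_cast hq
  have hrc : r * c ≤ 1 := by
    refine le_trans ?_ hqc
    gcongr
    nlinarith
  let Q : GAPData G r := ⟨0, u, fun i => -(N i : ℤ), fun i => N i, fun i => by omega⟩
  let B : Finset (Fin r → ℤ) := Fintype.piFinset fun i => Finset.Icc (-(N i : ℤ)) (N i)
  have hBmem : ∀ m, m ∈ B ↔ ∀ i, -(N i : ℤ) ≤ m i ∧ m i ≤ N i := by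
    intro m; simp [B]
  have hQset : Q.toSet = (fun m : Fin r → ℤ => ∑ i, m i • u i) '' (B : Set (Fin r → ℤ)) := by
    ext x
    simp only [GAPData.toSet, Q, Set.mem_ofPred_eq, zero_add, Set.mem_image, Finset.mem_coe, hBmem]
    constructor
    · rintro ⟨m, h1, h2⟩; exact ⟨m, h1, h2.symm⟩
    · rintro ⟨m, h1, h2⟩; exact ⟨m, h1, h2.symm⟩
  have hcong : ∀ m m' : Fin r → ℤ, (∀ i, -(N i : ℤ) ≤ m i ∧ m i ≤ N i) →
      (∀ i, -(N i : ℤ) ≤ m' i ∧ m' i ≤ N i) →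
      ∑ i, m i • u i - ∑ i, m' i • u i ∈ relKernel R → m = m' := by
    intro m m' hm hm' h
    refine sub_eq_zero.1 (eq_zero_of_sum_zsmul_mem_relKernel hsep hu hind (m := m - m')
      (c := 2 * c) (by linarith) ?_ ?_)
    · intro i
      have h1 : |(((m - m') i : ℤ) : ℝ)| ≤ 2 * N i := by
        have h2 : |(m - m') i| ≤ 2 * (N i : ℤ) := by
          have := hm i; have := hm' i
          rw [Pi.sub_apply, abs_le]; constructor <;> linarith
        exact_mod_cast h2
      nlinarith [hb i, norm_nonneg (b i)]
    · simpa [sub_smul, Finset.sum_sub_distrib] using h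
  have hinj : Set.InjOn (fun p : G × (Fin r → ℤ) => p.1 + ∑ i, p.2 i • u i)
      ((relKernel R : Set G) ×ˢ (B : Set (Fin r → ℤ))) := by
    rintro ⟨h, m⟩ ⟨hh, hm⟩ ⟨h', m'⟩ ⟨hh', hm'⟩ heq
    simp only at heq hh hh' hm hm'
    have h1 : ∑ i, m i • u i - ∑ i, m' i • u i = h' - h := by
      rw [sub_eq_sub_iff_add_eq_add, add_comm, heq]
    have h2 : m = m' := by
      refine hcong m m' ((hBmem m).1 hm) ((hBmem m').1 hm') ?_
      rw [h1]; exact (relKernel R).sub_mem hh' hh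
    subst h2
    simpa using heq
  have himg : (fun p : G × (Fin r → ℤ) => p.1 + ∑ i, p.2 i • u i) ''
      ((relKernel R : Set G) ×ˢ (B : Set (Fin r → ℤ))) = (relKernel R : Set G) + Q.toSet := by
    rw [hQset]
    ext x
    constructor
    · rintro ⟨⟨h, m⟩, ⟨hh, hm⟩, rfl⟩
      exact Set.add_mem_add hh ⟨m, hm, rfl⟩
    · rintro ⟨h, hh, _, ⟨m, hm, rfl⟩, rfl⟩
      exact ⟨⟨h, m⟩, ⟨hh, hm⟩, rfl⟩
  have hQinj : Set.InjOn (fun m : Fin r → ℤ => ∑ i, m i • u i) (B : Set (Fin r → ℤ)) := by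
    intro m hm m' hm' heq
    refine hcong m m' ((hBmem m).1 hm) ((hBmem m').1 hm') ?_
    simp only at heq
    rw [heq, sub_self]
    exact (relKernel R).zero_mem
  have hcardQ : Q.toSet.ncard = ∏ i, (2 * N i + 1) := by
    rw [hQset, hQinj.ncard_image, Set.ncard_coe_finset, card_pi_Icc]
  have hcard : ((relKernel R : Set G) + Q.toSet).ncard =
      (relKernel R : Set G).ncard * ∏ i, (2 * N i + 1) := by
    rw [← himg, hinj.ncard_image, Set.ncard_prod, Set.ncard_coe_finset, card_pi_Icc]
  refine ⟨Q, ⟨rfl, fun i => rfl⟩, ⟨Set.toFinite _, ?_, by rw [hcard, hcardQ]⟩, ?_, ?_⟩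
  · intro m m' hm hm' heq
    refine hQinj ((hBmem m).2 hm) ((hBmem m').2 hm') ?_
    simpa using heq
  · intro x hx
    obtain ⟨m, hm, hmN⟩ := hX x hx
    refine ⟨x - ∑ i, m i • u i, ?_, ∑ i, m i • u i, ?_, by simp⟩
    · have := R.sub_mem hm (sum_zsmul_mem_relation hu m)
      simpa [mem_relKernel] using this
    · rw [hQset]
      exact ⟨m, (hBmem m).2 fun i => abs_le.1 (hmN i), rfl⟩
  · let B' : Finset (Fin r → ℤ) :=
      Fintype.piFinset fun i => Finset.Icc (-((q * N i : ℕ) : ℤ)) ((q * N i : ℕ) : ℤ)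
    have hB' : ∀ m ∈ B', ∀ i, |(m i : ℝ)| * ‖b i‖ ≤ q * c := by
      intro m hm i
      have h1 : |m i| ≤ ((q * N i : ℕ) : ℤ) := by
        have := Fintype.mem_piFinset.1 hm i
        exact abs_le.2 (Finset.mem_Icc.1 this)
      have h2 : |(m i : ℝ)| ≤ q * N i := by exact_mod_cast h1
      calc |(m i : ℝ)| * ‖b i‖ ≤ (q * N i) * ‖b i‖ := by gcongr
        _ = q * (N i * ‖b i‖) := by ring
        _ ≤ q * c := by gcongr; exact hb i
    have hB'n : ∀ m ∈ B', ‖∑ i, m i • b i‖ ≤ 1 := fun m hm =>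
      (norm_sum_zsmul_le b m (hB' m hm)).trans hqc
    have hS := ncard_relFibre hsep (B'.image fun m => ∑ i, m i • b i)
      (by
        intro v hv
        obtain ⟨m, hm, rfl⟩ := Finset.mem_image.1 hv
        exact ⟨_, sum_zsmul_mem_relation hu m⟩)
      (by
        intro v hv v' hv'
        obtain ⟨m, hm, rfl⟩ := Finset.mem_image.1 hv
        obtain ⟨m', hm', rfl⟩ := Finset.mem_image.1 hv'
        have := norm_sub_le (∑ i, m i • b i) (∑ i, m' i • b i)
        have := hB'n m hm
        have := hB'n m' hm'
        linarith)
    have hcardS : (B'.image fun m => ∑ i, m i • b i).card = ∏ i, (2 * (q * N i) + 1) := by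
      rw [Finset.card_image_of_injective, card_pi_Icc]
      intro m m' heq
      refine sub_eq_zero.1 (hind (m - m') ?_)
      simp only at heq
      simp [sub_smul, Finset.sum_sub_distrib, heq]
    rw [hcardS] at hS
    have hsub : {x : G | ∃ v ∈ B'.image (fun m => ∑ i, m i • b i), (x, v) ∈ R}.ncard ≤
        {x : G | ∃ v, (x, v) ∈ R ∧ ‖v‖ ≤ 1}.ncard := by
      apply Set.ncard_le_ncard _ (Set.toFinite _)
      rintro x ⟨v, hv, hx⟩
      obtain ⟨m, hm, rfl⟩ := Finset.mem_image.1 hv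
      exact ⟨_, hx, hB'n m hm⟩
    rw [hS] at hsub
    have hprod : q ^ r * ∏ i, (2 * N i + 1) ≤ 2 ^ r * ∏ i, (2 * (q * N i) + 1) := by
      have h1 : ∀ z : ℕ, z ^ r = ∏ _i : Fin r, z := by intro z; simp
      rw [h1, h1, ← Finset.prod_mul_distrib, ← Finset.prod_mul_distrib]
      refine Finset.prod_le_prod' fun i _ => ?_
      have := hN i
      nlinarith
    rw [hcard]
    calc q ^ r * ((relKernel R : Set G).ncard * ∏ i, (2 * N i + 1))
        = (relKernel R : Set G).ncard * (q ^ r * ∏ i, (2 * N i + 1)) := by ring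
      _ ≤ (relKernel R : Set G).ncard * (2 ^ r * ∏ i, (2 * (q * N i) + 1)) := by gcongr
      _ = 2 ^ r * ((relKernel R : Set G).ncard * ∏ i, (2 * (q * N i) + 1)) := by ring
      _ ≤ _ := by gcongr

theorem exists_cosetProg_of_relation {G V : Type} [AddCommGroup G] [Fintype G]
    [NormedAddCommGroup V] [NormedSpace ℝ V] [FiniteDimensional ℝ V]
    {R : AddSubgroup (G × V)} (hsep : ∀ v : V, ((0 : G), v) ∈ R → ‖v‖ < 18 → v = 0)
    (hfin : ∀ ρ : ℝ, {v : V | v ∈ R.map (AddMonoidHom.snd G V) ∧ ‖v‖ ≤ ρ}.Finite)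
    {X W : Set G} {w κ : ℕ} (hκ : 1 ≤ κ) (hw : κ * (3 * κ + 1) ^ κ ≤ w)
    (hX : ∀ x ∈ X, ∀ n ≤ w, n • x ∈ W)
    (hW : ∀ y ∈ W, ∃ v, (y, v) ∈ R ∧ ‖v‖ ≤ 1)
    (hB : {x : G | ∃ v, (x, v) ∈ R ∧ ‖v‖ ≤ 3}.ncard ≤ κ * W.ncard) :
    ∃ (r : ℕ) (H : AddSubgroup G) (Q : GAPData G r), Q.IsSymmetric ∧ IsProperCosetProg H Q ∧
      X ⊆ (H : Set G) + Q.toSet ∧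
      w ^ r * ((H : Set G) + Q.toSet).ncard ≤
        (4 * κ * (3 * κ + 1) ^ κ) ^ κ * κ * W.ncard := by
  set S : Set V := {v | v ∈ R.map (AddMonoidHom.snd G V) ∧ ‖v‖ ≤ 1} with hSdef
  have hSle : AddSubgroup.closure S ≤ R.map (AddMonoidHom.snd G V) :=
    (AddSubgroup.closure_le _).2 fun v hv => hv.1
  obtain ⟨r₀, v, hvL, hind, hcoord⟩ := exists_reduced_basis _ V rfl (AddSubgroup.closure S)
    (fun ρ => (hfin ρ).subset fun x hx => ⟨hSle hx.1, hx.2⟩)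
  have hWB : W ⊆ {x : G | ∃ v, (x, v) ∈ R ∧ ‖v‖ ≤ 1} := fun y hy => hW y hy
  have hr₀ : r₀ ≤ κ := by
    apply rank_le_of_relation hsep hfin hvL hind
    · intro x hx
      obtain ⟨m, hm, -⟩ := hcoord x hx
      exact ⟨m, hm⟩
    · exact hB.trans (Nat.mul_le_mul_left _ (Set.ncard_le_ncard hWB (Set.toFinite _)))
  set C : ℕ := (3 * κ + 1) ^ κ with hC
  have hC1 : 1 ≤ C := Nat.one_le_pow _ _ (by omega)
  have hκC : 1 ≤ κ * C := Nat.mul_pos hκ hC1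
  have hw1 : 1 ≤ w := hκC.trans hw
  have hw1' : (0 : ℝ) < w := by exact_mod_cast hw1
  have hCR : (3 * r₀ + 1 : ℝ) ^ r₀ ≤ C := by
    have : (3 * r₀ + 1) ^ r₀ ≤ C :=
      (Nat.pow_le_pow_left (by omega) _).trans (Nat.pow_le_pow_right (by omega) hr₀)
    exact_mod_cast this
  have hC0 : (0 : ℝ) < C := by exact_mod_cast hC1
  obtain ⟨r, e, N, hr, hinde, hN, hNb, hbox⟩ := exists_adapted_box (L := AddSubgroup.closure S)
    (C := C) (ε := 1 / w) (by positivity) hC0.le hind (by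
      intro x hx
      obtain ⟨m, hm, hmb⟩ := hcoord x hx
      exact ⟨m, hm, fun i => (hmb i).trans (by gcongr)⟩)
  have hu : ∀ i, ∃ u : G, (u, v (e i)) ∈ R := by
    intro i
    simpa using hSle (hvL (e i))
  choose u hu using hu
  have hq : 1 ≤ w / (κ * C) := (Nat.one_le_div_iff hκC).2 hw
  have hrκ : r ≤ κ := hr.trans hr₀
  have hqc : (r : ℝ) * (((w / (κ * C) : ℕ) : ℝ) * (C * (1 / w))) ≤ 1 := by
    have h1 : r * (w / (κ * C) * C) ≤ w := by
      calc r * (w / (κ * C) * C) ≤ κ * (w / (κ * C) * C) := by gcongr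
        _ = κ * C * (w / (κ * C)) := by ring
        _ ≤ w := Nat.mul_div_le _ _
    have h2 : (r : ℝ) * (((w / (κ * C) : ℕ) : ℝ) * C) ≤ w := by exact_mod_cast h1
    rw [← div_le_one hw1'] at h2
    calc (r : ℝ) * (((w / (κ * C) : ℕ) : ℝ) * (C * (1 / w)))
        = (r : ℝ) * (((w / (κ * C) : ℕ) : ℝ) * C) / w := by ring
      _ ≤ 1 := h2
  obtain ⟨Q, hQs, hQp, hQX, hQc⟩ := exists_cosetProg_of_box hsep hu hinde hN hNb hq
    (by positivity) hqc (X := X) (by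
      intro x hx
      obtain ⟨y, hy, hyw⟩ := exists_small_lift hsep hw1 fun n hn => hW _ (hX x hx n hn)
      have hyS : y ∈ S := by
        refine ⟨by simpa using ⟨x, hy⟩, hyw.trans ?_⟩
        rw [div_le_one hw1']
        exact_mod_cast hw1
      obtain ⟨m, hm, hmN⟩ := hbox y (AddSubgroup.subset_closure hyS) hyw
      exact ⟨m, hm ▸ hy, hmN⟩)
  refine ⟨r, relKernel R, Q, hQs, hQp, hQX, ?_⟩
  have hB1 : {x : G | ∃ v, (x, v) ∈ R ∧ ‖v‖ ≤ 1}.ncard ≤ κ * W.ncard := by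
    refine le_trans (Set.ncard_le_ncard ?_ (Set.toFinite _)) hB
    rintro x ⟨v, h1, h2⟩
    exact ⟨v, h1, h2.trans (by norm_num)⟩
  have hwq : w ≤ 2 * (κ * C) * (w / (κ * C)) := by
    have h1 := Nat.div_add_mod w (κ * C)
    have h2 := Nat.mod_lt w hκC
    nlinarith
  calc w ^ r * ((relKernel R : Set G) + Q.toSet).ncard
      ≤ (2 * (κ * C) * (w / (κ * C))) ^ r * ((relKernel R : Set G) + Q.toSet).ncard := by gcongr
    _ = (2 * (κ * C)) ^ r *
        ((w / (κ * C)) ^ r * ((relKernel R : Set G) + Q.toSet).ncard) := by ring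
    _ ≤ (2 * (κ * C)) ^ r * (2 ^ r * (κ * W.ncard)) := by
        exact Nat.mul_le_mul_left _ (hQc.trans (Nat.mul_le_mul_left _ hB1))
    _ = (4 * κ * C) ^ r * κ * W.ncard := by
        rw [show 4 * κ * C = 2 * (κ * C) * 2 by ring, mul_pow _ 2]; ring
    _ ≤ (4 * κ * C) ^ κ * κ * W.ncard := by
        gcongr
        nlinarith

/-- The additive relation of pairs `(x, v)` such that `v` is a vector of phases of the values at `x`
of the characters in `Λ`, in units of `π / 9`. -/
noncomputable def phaseRelation {G : Type} [AddCommGroup G] (Λ : Finset (AddChar G ℂ)) :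
    AddSubgroup (G × (Λ → ℝ)) where
  carrier := {p | ∀ χ : Λ, χ.1 p.1 = Complex.exp ((p.2 χ * (Real.pi / 9) : ℝ) * Complex.I)}
  zero_mem' := by intro χ; simp
  add_mem' := by
    intro p q hp hq χ
    simp only [Set.mem_ofPred_eq, Prod.fst_add, Prod.snd_add, Pi.add_apply,
      AddChar.map_add_eq_mul] at *
    rw [hp χ, hq χ, ← Complex.exp_add]
    congr 1
    push_cast
    ring
  neg_mem' := by
    intro p hp χ
    simp only [Set.mem_ofPred_eq, Prod.fst_neg, Prod.snd_neg, Pi.neg_apply,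
      AddChar.map_neg_eq_inv] at *
    rw [hp χ, ← Complex.exp_neg]
    congr 1
    push_cast
    ring

theorem mem_phaseRelation {G : Type} [AddCommGroup G] {Λ : Finset (AddChar G ℂ)} {x : G}
    {v : Λ → ℝ} : (x, v) ∈ phaseRelation Λ ↔
      ∀ χ : Λ, χ.1 x = Complex.exp ((v χ * (Real.pi / 9) : ℝ) * Complex.I) := Iff.rfl

theorem exists_eq_of_exp_phase_eq_one {t : ℝ}
    (h : Complex.exp ((t * (Real.pi / 9) : ℝ) * Complex.I) = 1) : ∃ n : ℤ, t = 18 * n := by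
  obtain ⟨n, hn⟩ := Complex.exp_eq_one_iff.1 h
  refine ⟨n, ?_⟩
  have h1 : ((t * (Real.pi / 9) : ℝ) : ℂ) = ((n * (2 * Real.pi) : ℝ) : ℂ) := by
    apply mul_right_cancel₀ Complex.I_ne_zero
    rw [hn]
    push_cast
    ring
  have h2 : t * (Real.pi / 9) = n * (2 * Real.pi) := by exact_mod_cast h1
  have := Real.pi_pos
  field_simp at h2
  linarith

theorem phaseRelation_separated {G : Type} [AddCommGroup G] {Λ : Finset (AddChar G ℂ)}
    (v : Λ → ℝ) (hv : ((0 : G), v) ∈ phaseRelation Λ) (hn : ‖v‖ < 18) : v = 0 := by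
  funext χ
  have h1 := mem_phaseRelation.1 hv χ
  rw [AddChar.map_zero_eq_one] at h1
  obtain ⟨n, h2⟩ := exists_eq_of_exp_phase_eq_one h1.symm
  have h3 : |v χ| < 18 := (norm_le_pi_norm v χ).trans_lt hn
  rw [h2, abs_mul, abs_of_pos (by norm_num : (0 : ℝ) < 18)] at h3
  have h4 : |(n : ℝ)| < 1 := by linarith
  have h5 : n = 0 := Int.abs_lt_one_iff.1 (by exact_mod_cast h4)
  simp [h2, h5]

theorem finite_phaseRelation {G : Type} [AddCommGroup G] [Fintype G] (Λ : Finset (AddChar G ℂ))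
    (ρ : ℝ) :
    {v | v ∈ (phaseRelation Λ).map (AddMonoidHom.snd G (Λ → ℝ)) ∧ ‖v‖ ≤ ρ}.Finite := by
  let g := Fintype.card G
  have hg : (0 : ℝ) < g := by exact_mod_cast Fintype.card_pos
  refine (Set.Finite.pi' (t := fun _ : Λ => (fun n : ℤ => (18 * n / g : ℝ)) ''
    Set.Icc (-⌈g * ρ⌉) ⌈g * ρ⌉) fun _ => (Set.finite_Icc _ _).image _).subset ?_
  rintro v ⟨⟨⟨x, v'⟩, hx, rfl⟩, hρ⟩ χ
  simp only [AddMonoidHom.coe_snd] at hρ ⊢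
  have h1 := mem_phaseRelation.1 hx χ
  have h2 : χ.1 x ^ g = 1 := by
    rw [← AddChar.map_nsmul_eq_pow, card_nsmul_eq_zero, AddChar.map_zero_eq_one]
  rw [h1, ← Complex.exp_nat_mul] at h2
  obtain ⟨n, hn⟩ := exists_eq_of_exp_phase_eq_one (t := g * v' χ) (by
    rw [← h2]
    congr 1
    push_cast
    ring)
  have h3 : |v' χ| ≤ ρ := (norm_le_pi_norm v' χ).trans hρ
  refine ⟨n, ?_, by simp only; rw [← hn]; field_simp⟩
  have h4 : |(n : ℝ)| ≤ g * ρ := by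
    have h5 : (18 : ℝ) * |(n : ℝ)| ≤ g * ρ := by
      calc (18 : ℝ) * |(n : ℝ)| = |18 * (n : ℝ)| := by rw [abs_mul]; norm_num
        _ = g * |v' χ| := by rw [← hn, abs_mul, abs_of_pos hg]
        _ ≤ g * ρ := by gcongr
    linarith [abs_nonneg (n : ℝ)]
  have h6 : |n| ≤ ⌈g * ρ⌉ := by
    have h7 : ((|n| : ℤ) : ℝ) ≤ ⌈g * ρ⌉ := by
      push_cast
      exact h4.trans (Int.le_ceil _)
    exact_mod_cast h7
  exact abs_le.1 h6

theorem exists_cosetProg_of_characters {G : Type} [AddCommGroup G] [Fintype G]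
    (Λ : Finset (AddChar G ℂ)) {X W : Set G} {w κ : ℕ} (hκ : 1 ≤ κ)
    (hw : κ * (3 * κ + 1) ^ κ ≤ w) (hX : ∀ x ∈ X, ∀ n ≤ w, n • x ∈ W)
    (hW : ∀ y ∈ W, ∀ χ ∈ Λ, |(χ y).arg| ≤ Real.pi / 9)
    (hB : {x : G | ∀ χ ∈ Λ, 1 / 2 ≤ (χ x).re}.ncard ≤ κ * W.ncard) :
    ∃ (r : ℕ) (H : AddSubgroup G) (Q : GAPData G r), Q.IsSymmetric ∧ IsProperCosetProg H Q ∧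
      X ⊆ (H : Set G) + Q.toSet ∧
      w ^ r * ((H : Set G) + Q.toSet).ncard ≤
        (4 * κ * (3 * κ + 1) ^ κ) ^ κ * κ * W.ncard := by
  have hpi := Real.pi_pos
  refine exists_cosetProg_of_relation (R := phaseRelation Λ) phaseRelation_separated
    (finite_phaseRelation Λ) hκ hw hX ?_ ?_
  · intro y hy
    refine ⟨fun χ => (χ.1 y).arg / (Real.pi / 9), ?_, ?_⟩
    · rw [mem_phaseRelation]
      intro χ
      rw [div_mul_cancel₀ _ (by positivity)]
      have h1 := Complex.norm_mul_exp_arg_mul_I (χ.1 y)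
      rw [AddChar.norm_apply, Complex.ofReal_one, one_mul] at h1
      exact h1.symm
    · rw [pi_norm_le_iff_of_nonneg zero_le_one]
      intro χ
      rw [Real.norm_eq_abs, abs_div, abs_of_pos (by positivity : 0 < Real.pi / 9),
        div_le_one (by positivity)]
      exact hW y hy χ.1 χ.2
  · refine le_trans (Set.ncard_le_ncard ?_ (Set.toFinite _)) hB
    rintro x ⟨v, hx, hv⟩ χ hχ
    rw [mem_phaseRelation.1 hx ⟨χ, hχ⟩, Complex.exp_ofReal_mul_I_re]
    have h1 : |v ⟨χ, hχ⟩| ≤ 3 := (norm_le_pi_norm v _).trans hv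
    rw [← Real.cos_abs, ← Real.cos_pi_div_three]
    apply Real.cos_le_cos_of_nonneg_of_le_pi (abs_nonneg _) (by linarith)
    rw [abs_mul, abs_of_pos (by positivity : 0 < Real.pi / 9)]
    nlinarith

open scoped Classical in
theorem exists_convolution_power {G : Type} [AddCommGroup G] [Fintype G] (A : Finset G) (j : ℕ) :
    ∃ f : G → ℂ, (∀ x, f x ≠ 0 → x ∈ j • A) ∧
      ∀ χ : AddChar G ℂ, ∑ x, f x * χ x = (∑ a ∈ A, χ a) ^ j := by
  induction j with
  | zero =>
    refine ⟨fun x => if x = 0 then 1 else 0, fun x hx => ?_, fun χ => ?_⟩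
    · simpa using hx
    · simp
  | succ j ih =>
    obtain ⟨f, hf, hχ⟩ := ih
    refine ⟨fun x => ∑ a ∈ A, f (x - a), fun x hx => ?_, fun χ => ?_⟩
    · obtain ⟨a, ha, h⟩ := Finset.exists_ne_zero_of_sum_ne_zero hx
      rw [succ_nsmul]
      exact Finset.mem_add.mpr ⟨x - a, hf _ h, a, ha, sub_add_cancel _ _⟩
    · simp only [Finset.sum_mul]
      rw [Finset.sum_comm, pow_succ, Finset.mul_sum]
      refine Finset.sum_congr rfl fun a _ => ?_
      rw [← hχ χ, Finset.sum_mul, ← Equiv.sum_comp (Equiv.addRight a)]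
      refine Finset.sum_congr rfl fun x _ => ?_
      simp [AddChar.map_add_eq_mul, mul_assoc]

theorem sum_normSq_fourier {G : Type} [AddCommGroup G] [Fintype G] (f : G → ℂ) :
    ∑ χ : AddChar G ℂ, ‖∑ x, f x * χ x‖ ^ 2 = Fintype.card G * ∑ x, ‖f x‖ ^ 2 := by
  classical
  have key : ∀ χ : AddChar G ℂ, ((‖∑ x, f x * χ x‖ ^ 2 : ℝ) : ℂ) =
      ∑ x, ∑ y, f x * (starRingEnd ℂ) (f y) * χ (x - y) := by
    intro χ
    push_cast
    rw [← Complex.mul_conj', map_sum, Finset.sum_mul_sum]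
    refine Finset.sum_congr rfl fun x _ => Finset.sum_congr rfl fun y _ => ?_
    rw [map_mul, sub_eq_add_neg, AddChar.map_add_eq_mul, AddChar.map_neg_eq_conj]
    ring
  apply Complex.ofReal_injective
  rw [Complex.ofReal_sum]
  simp only [key]
  rw [Finset.sum_comm]
  push_cast
  rw [Finset.mul_sum]
  refine Finset.sum_congr rfl fun x _ => ?_
  rw [Finset.sum_comm]
  simp only [← Finset.mul_sum, AddChar.sum_apply_eq_ite, sub_eq_zero]
  simp only [mul_ite, mul_zero, Finset.sum_ite_eq, Finset.mem_univ, if_true]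
  rw [Complex.mul_conj']
  ring

theorem sum_normSq_sum_addChar {G : Type} [AddCommGroup G] [Fintype G]
    (Λ : Finset (AddChar G ℂ)) :
    ∑ x : G, ‖∑ χ ∈ Λ, χ x‖ ^ 2 = Fintype.card G * (Λ.card : ℝ) := by
  classical
  have key : ∀ x : G, ((‖∑ χ ∈ Λ, χ x‖ ^ 2 : ℝ) : ℂ) =
      ∑ χ ∈ Λ, ∑ ψ ∈ Λ, (χ - ψ) x := by
    intro x
    push_cast
    rw [← Complex.mul_conj', map_sum, Finset.sum_mul_sum]
    refine Finset.sum_congr rfl fun χ _ => Finset.sum_congr rfl fun ψ _ => ?_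
    rw [AddChar.sub_apply, AddChar.map_neg_eq_conj]
  apply Complex.ofReal_injective
  rw [Complex.ofReal_sum]
  simp only [key]
  rw [Finset.sum_comm]
  have : ∀ χ ∈ Λ, ∑ x : G, ∑ ψ ∈ Λ, (χ - ψ) x = (Fintype.card G : ℂ) := by
    intro χ hχ
    rw [Finset.sum_comm]
    simp only [AddChar.sum_eq_ite, sub_eq_zero]
    simp [hχ]
  rw [Finset.sum_congr rfl this]
  simp [mul_comm]

open scoped Classical in
/-- The large spectrum of a set. -/
noncomputable def largeSpectrum {G : Type} [AddCommGroup G] [Fintype G] (A : Finset G) :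
    Finset (AddChar G ℂ) :=
  Finset.univ.filter fun χ => (A.card : ℝ) / 2 ≤ ‖∑ a ∈ A, χ a‖

open scoped Classical in
theorem card_le_card_largeSpectrum {G : Type} [AddCommGroup G] [Fintype G] (A : Finset G)
    (hA : A.Nonempty) (j : ℕ) (hj : 2 * (((j + 1) • A).card : ℝ) ≤ 4 ^ j * A.card) :
    (Fintype.card G : ℝ) ≤ 2 * ((j + 1) • A).card * (largeSpectrum A).card := by
  obtain ⟨f, hf, hχ⟩ := exists_convolution_power A (j + 1)
  set S := (j + 1) • A with hS
  have hA0 : (0 : ℝ) < A.card := by exact_mod_cast hA.card_pos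
  have hS0 : (0 : ℝ) < S.card := by exact_mod_cast (hA.nsmul).card_pos
  have hG0 : (0 : ℝ) < Fintype.card G := by
    exact_mod_cast Fintype.card_pos_iff.mpr ⟨(0 : G)⟩
  have h1 := sum_normSq_fourier f
  simp only [hχ, norm_pow, ← pow_mul] at h1
  have h0 : ∑ x ∈ S, f x = (A.card : ℂ) ^ (j + 1) := by
    have := hχ 0
    simp only [AddChar.zero_apply, mul_one, Finset.sum_const, nsmul_eq_mul] at this
    rw [← this]
    refine Finset.sum_subset (Finset.subset_univ _) fun x _ hx => ?_
    by_contra h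
    exact hx (hf x h)
  have h2 : (A.card : ℝ) ^ ((j + 1) * 2) ≤ S.card * ∑ x, ‖f x‖ ^ 2 := by
    calc (A.card : ℝ) ^ ((j + 1) * 2) = ‖∑ x ∈ S, f x‖ ^ 2 := by
          rw [h0]; simp [pow_mul]
      _ ≤ (∑ x ∈ S, ‖f x‖) ^ 2 := by gcongr; exact norm_sum_le _ _
      _ ≤ S.card * ∑ x ∈ S, ‖f x‖ ^ 2 := sq_sum_le_card_mul_sum_sq
      _ ≤ S.card * ∑ x, ‖f x‖ ^ 2 := by
          gcongr; exact Finset.subset_univ _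
  -- the trivial convolution power
  have h3 : ∑ χ : AddChar G ℂ, ‖∑ a ∈ A, χ a‖ ^ 2 = Fintype.card G * (A.card : ℝ) := by
    have := sum_normSq_fourier (fun x => if x ∈ A then (1 : ℂ) else 0)
    simpa [apply_ite] using this
  have h4 : ∑ χ : AddChar G ℂ, ‖∑ a ∈ A, χ a‖ ^ ((j + 1) * 2) ≤
      (largeSpectrum A).card * (A.card : ℝ) ^ ((j + 1) * 2) +
        ((A.card : ℝ) / 2) ^ (2 * j) * (Fintype.card G * (A.card : ℝ)) := by
    rw [← Finset.sum_filter_add_sum_filter_not Finset.univ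
      (fun χ : AddChar G ℂ => (A.card : ℝ) / 2 ≤ ‖∑ a ∈ A, χ a‖)]
    gcongr
    · rw [← nsmul_eq_mul]
      refine Finset.sum_le_card_nsmul _ _ _ fun χ _ => ?_
      gcongr
      refine (norm_sum_le _ _).trans ?_
      simp
    · rw [← h3, Finset.mul_sum]
      refine (Finset.sum_le_sum fun χ hχ' => ?_).trans
        (Finset.sum_le_sum_of_subset_of_nonneg (Finset.subset_univ _) fun _ _ _ => by positivity)
      have h5 : ‖∑ a ∈ A, χ a‖ ≤ (A.card : ℝ) / 2 := by
        have := (Finset.mem_filter.mp hχ').2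
        exact (not_le.mp this).le
      rw [show (j + 1) * 2 = 2 * j + 2 by ring, pow_add]
      gcongr
  have h6 : (Fintype.card G : ℝ) * (A.card : ℝ) ^ ((j + 1) * 2) ≤
      S.card * ((largeSpectrum A).card * (A.card : ℝ) ^ ((j + 1) * 2)) +
        S.card * (((A.card : ℝ) / 2) ^ (2 * j) * (Fintype.card G * (A.card : ℝ))) := by
    rw [← mul_add]
    calc (Fintype.card G : ℝ) * (A.card : ℝ) ^ ((j + 1) * 2)
        ≤ Fintype.card G * (S.card * ∑ x, ‖f x‖ ^ 2) := by gcongr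
      _ = S.card * (Fintype.card G * ∑ x, ‖f x‖ ^ 2) := by ring
      _ ≤ _ := by rw [← h1]; gcongr
  have h7 : (S.card : ℝ) * (((A.card : ℝ) / 2) ^ (2 * j) * (Fintype.card G * (A.card : ℝ))) ≤
      Fintype.card G * (A.card : ℝ) ^ ((j + 1) * 2) / 2 := by
    have h8 : ((A.card : ℝ) / 2) ^ (2 * j) = (A.card : ℝ) ^ (2 * j) / 4 ^ j := by
      rw [div_pow, pow_mul 2]; norm_num
    have h9 : (A.card : ℝ) ^ ((j + 1) * 2) = (A.card : ℝ) ^ (2 * j) * A.card * A.card := by ring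
    rw [h8, h9]
    have : (S.card : ℝ) ≤ 4 ^ j * A.card / 2 := by linarith
    calc (S.card : ℝ) * ((A.card : ℝ) ^ (2 * j) / 4 ^ j * (Fintype.card G * (A.card : ℝ)))
        ≤ (4 ^ j * A.card / 2) * ((A.card : ℝ) ^ (2 * j) / 4 ^ j *
          (Fintype.card G * (A.card : ℝ))) := by gcongr
      _ = _ := by field_simp
  have h10 : (0 : ℝ) < (A.card : ℝ) ^ ((j + 1) * 2) := by positivity
  nlinarith

theorem card_bohr_le {G : Type} [AddCommGroup G] [Fintype G] (Λ : Finset (AddChar G ℂ))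
    (B : Finset G) (hB : ∀ x ∈ B, ∀ χ ∈ Λ, 1 / 2 ≤ (χ x).re) :
    (B.card : ℝ) * Λ.card ≤ 4 * Fintype.card G := by
  have h1 := sum_normSq_sum_addChar Λ
  rcases Λ.eq_empty_or_nonempty with h | h
  · subst h; simp
  have hΛ : (0 : ℝ) < Λ.card := by exact_mod_cast h.card_pos
  have h2 : (B.card : ℝ) * ((Λ.card : ℝ) / 2) ^ 2 ≤ ∑ x : G, ‖∑ χ ∈ Λ, χ x‖ ^ 2 := by
    calc (B.card : ℝ) * ((Λ.card : ℝ) / 2) ^ 2 ≤ ∑ x ∈ B, ‖∑ χ ∈ Λ, χ x‖ ^ 2 := by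
          rw [← nsmul_eq_mul]
          refine Finset.card_nsmul_le_sum _ _ _ fun x hx => ?_
          gcongr
          refine le_trans ?_ (Complex.re_le_norm _)
          rw [Complex.re_sum]
          calc (Λ.card : ℝ) / 2 = Λ.card • (1 / 2 : ℝ) := by simp [div_eq_mul_inv]
            _ ≤ _ := Finset.card_nsmul_le_sum _ _ _ fun χ hχ => hB x hx χ hχ
      _ ≤ _ := by gcongr; exact Finset.subset_univ _
  rw [h1] at h2
  have : (B.card : ℝ) * Λ.card * Λ.card ≤ 4 * Fintype.card G * Λ.card := by nlinarith
  exact le_of_mul_le_mul_right this hΛ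

open scoped Classical in
theorem abs_arg_le_of_mem_largeSpectrum {G : Type} [AddCommGroup G] [Fintype G]
    {A W : Finset G} (hA : A.Nonempty) (h0 : (0 : G) ∈ W)
    (h : 18 * ((A + W).card : ℝ) ≤ 19 * A.card) {χ : AddChar G ℂ} (hχ : χ ∈ largeSpectrum A)
    {y : G} (hy : y ∈ W) : |(χ y).arg| ≤ Real.pi / 9 := by
  have hA0 : (0 : ℝ) < A.card := by exact_mod_cast hA.card_pos
  set B : Finset G := A.image (· + y) with hBdef
  have hBcard : B.card = A.card := Finset.card_image_of_injective _ (add_left_injective y)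
  have hAW : A ⊆ A + W := fun a ha => Finset.mem_add.mpr ⟨a, ha, 0, h0, add_zero a⟩
  have hBW : B ⊆ A + W := by
    intro b hb
    obtain ⟨a, ha, rfl⟩ := Finset.mem_image.mp hb
    exact Finset.add_mem_add ha hy
  have hBsum : ∑ b ∈ B, χ b = χ y * ∑ a ∈ A, χ a := by
    rw [hBdef, Finset.sum_image fun _ _ _ _ h => add_left_injective y h, Finset.mul_sum]
    exact Finset.sum_congr rfl fun a _ => by rw [AddChar.map_add_eq_mul, mul_comm]
  have hbound : ∀ C : Finset G, C ⊆ A + W → C.card = A.card →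
      ‖∑ x ∈ (A + W) \ C, χ x‖ ≤ A.card / 18 := by
    intro C hC hcard
    refine (norm_sum_le _ _).trans ?_
    simp only [AddChar.norm_apply, Finset.sum_const, nsmul_eq_mul, mul_one]
    rw [Finset.cast_card_sdiff hC, hcard]
    linarith
  have h1 := hbound A hAW rfl
  have h2 := hbound B hBW hBcard
  have h3 := Finset.sum_sdiff (f := fun x => χ x) hAW
  have h4 := Finset.sum_sdiff (f := fun x => χ x) hBW
  have h5 : (χ y - 1) * ∑ a ∈ A, χ a = ∑ x ∈ (A + W) \ A, χ x - ∑ x ∈ (A + W) \ B, χ x := by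
    rw [sub_mul, ← hBsum, one_mul]
    linear_combination h4 - h3
  have h6 : ‖χ y - 1‖ * ‖∑ a ∈ A, χ a‖ ≤ A.card / 9 := by
    rw [← norm_mul, h5]
    exact (norm_sub_le _ _).trans (by linarith)
  have h7 : (A.card : ℝ) / 2 ≤ ‖∑ a ∈ A, χ a‖ := (Finset.mem_filter.mp hχ).2
  have h8 : ‖χ y - 1‖ ≤ 2 / 9 := by
    by_contra! hcon
    have : 2 / 9 * ((A.card : ℝ) / 2) < ‖χ y - 1‖ * ‖∑ a ∈ A, χ a‖ := by
      apply mul_lt_mul hcon h7 (by positivity) (by positivity)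
    linarith
  have h9 := (Complex.norm_sub_mem_Icc_angle (AddChar.norm_apply χ y) norm_one).1
  rw [Complex.angle_one_right (by rw [← norm_ne_zero_iff, AddChar.norm_apply]; simp)] at h9
  have hpi := Real.pi_pos
  have h10 : |(χ y).arg| = Real.pi / 2 * (2 / Real.pi * |(χ y).arg|) := by field_simp
  rw [h10]
  calc Real.pi / 2 * (2 / Real.pi * |(χ y).arg|) ≤ Real.pi / 2 * (2 / 9) := by
        gcongr; exact h9.trans h8
    _ = _ := by ring

section Growth

variable {G : Type} [AddCommGroup G] [DecidableEq G]

/-- The sums `∑ f ∈ F, m f • f` with coefficients `0 ≤ m f ≤ N`. -/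
def boxSum (F : Finset G) (N : ℕ) : Finset G :=
  (Fintype.piFinset fun _ : F => Finset.range (N + 1)).image
    fun m : F → ℕ => ∑ f, m f • (f : G)

theorem mem_boxSum {F : Finset G} {N : ℕ} {x : G} :
    x ∈ boxSum F N ↔ ∃ m : F → ℕ, (∀ f, m f ≤ N) ∧ ∑ f, m f • (f : G) = x := by
  simp only [boxSum, Finset.mem_image, Fintype.mem_piFinset, Finset.mem_range, Nat.lt_succ_iff]

theorem card_boxSum_le (F : Finset G) (N : ℕ) : (boxSum F N).card ≤ (N + 1) ^ F.card := by
  refine Finset.card_image_le.trans ?_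
  simp [Fintype.card_piFinset]

theorem nsmul_subset_nsmul_of_le {Y : Finset G} (h0 : (0 : G) ∈ Y) {a b : ℕ} (hab : a ≤ b) :
    a • Y ⊆ b • Y :=
  Finset.nsmul_subset_nsmul_right h0 hab

theorem sum_mem_nsmul {ι : Type*} (s : Finset ι) {Y : Finset G} (a : ι → G) (n : ι → ℕ)
    (h : ∀ i ∈ s, a i ∈ n i • Y) : ∑ i ∈ s, a i ∈ (∑ i ∈ s, n i) • Y := by
  classical
  induction s using Finset.induction_on with
  | empty => simp
  | insert i s hi ih =>
    rw [Finset.sum_insert hi, Finset.sum_insert hi, add_nsmul]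
    exact Finset.add_mem_add (h i (by simp)) (ih fun j hj => h j (by simp [hj]))

theorem nsmul_mem_nsmul_mul {Y : Finset G} {a : G} {k : ℕ} (h : a ∈ k • Y) (n : ℕ) :
    n • a ∈ (n * k) • Y := by
  have := sum_mem_nsmul (Finset.range n) (fun _ => a) (fun _ => k) fun _ _ => h
  simpa using this

theorem nsmul_sub_subset_boxSum {F Y : Finset G} (hF : 2 • Y - Y ⊆ F + (Y - Y)) (n : ℕ) :
    (n + 1) • Y - Y ⊆ boxSum F n + (Y - Y) := by
  induction n with
  | zero =>
    intro x hx
    refine Finset.mem_add.mpr ⟨0, mem_boxSum.mpr ⟨0, by simp, by simp⟩, x, by simpa using hx, ?_⟩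
    simp
  | succ n ih =>
    intro x hx
    obtain ⟨a, ha, b, hb, rfl⟩ := Finset.mem_sub.mp hx
    rw [succ_nsmul] at ha
    obtain ⟨a', ha', y, hy, rfl⟩ := Finset.mem_add.mp ha
    obtain ⟨p, hp, z, hz, hpz⟩ := Finset.mem_add.mp (ih (Finset.sub_mem_sub ha' hb))
    obtain ⟨y1, hy1, y2, hy2, rfl⟩ := Finset.mem_sub.mp hz
    have h1 : y + y1 - y2 ∈ 2 • Y - Y := by
      rw [two_nsmul]
      exact Finset.sub_mem_sub (Finset.add_mem_add hy hy1) hy2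
    obtain ⟨f, hf, z', hz', hfz⟩ := Finset.mem_add.mp (hF h1)
    obtain ⟨m, hm, rfl⟩ := mem_boxSum.mp hp
    refine Finset.mem_add.mpr ⟨∑ g, m g • (g : G) + f, mem_boxSum.mpr
      ⟨m + Pi.single ⟨f, hf⟩ 1, fun g => ?_, ?_⟩, z', hz', ?_⟩
    · have h2 := hm g
      have h3 : (Pi.single (⟨f, hf⟩ : F) 1 : F → ℕ) g ≤ 1 := by
        rw [Pi.single_apply]; split_ifs <;> omega
      simp only [Pi.add_apply]; omega
    · simp [Pi.single_apply, add_smul, Finset.sum_add_distrib, ite_smul]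
    · rw [add_assoc, hfz]
      have : a' - b + y = ∑ g, m g • (g : G) + (y1 - y2) + y := by rw [hpz]
      calc _ = ∑ g, m g • (g : G) + (y1 - y2) + y := by abel
        _ = _ := by rw [← this]; abel

theorem card_boxSum_add_le (F V : Finset G) {n N c : ℕ} (hN : 0 < N) (hn : n ≤ N * c) :
    (boxSum F n + V).card ≤ (c + 1) ^ F.card * (boxSum F N + V).card := by
  have hsub : boxSum F n + V ⊆ (boxSum F c).image (fun x => N • x) + (boxSum F N + V) := by
    intro x hx
    obtain ⟨p, hp, v, hv, rfl⟩ := Finset.mem_add.mp hx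
    obtain ⟨m, hm, rfl⟩ := mem_boxSum.mp hp
    refine Finset.mem_add.mpr ⟨N • ∑ f, (m f / N) • (f : G), Finset.mem_image_of_mem _
      (mem_boxSum.mpr ⟨fun f => m f / N, fun f => ?_, rfl⟩), ∑ f, (m f % N) • (f : G) + v,
      Finset.add_mem_add (mem_boxSum.mpr ⟨fun f => m f % N, fun f => (Nat.mod_lt _ hN).le, rfl⟩) hv,
      ?_⟩
    · exact Nat.div_le_of_le_mul ((hm f).trans hn)
    · rw [← add_assoc]
      congr 1
      rw [Finset.smul_sum, ← Finset.sum_add_distrib]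
      refine Finset.sum_congr rfl fun f _ => ?_
      rw [smul_smul, ← add_smul, Nat.div_add_mod]
  refine (Finset.card_le_card hsub).trans (Finset.card_add_le.trans ?_)
  gcongr
  exact Finset.card_image_le.trans (card_boxSum_le F c)

theorem exists_translate_boxSum {F Y : Finset G} (h0 : (0 : G) ∈ Y) (hF : F ⊆ 2 • Y - Y) (N : ℕ) :
    ∃ w : G, ∀ x ∈ boxSum F N, x + w ∈ (F.card * (N * 2)) • Y := by
  have : ∀ f : F, ∃ p q : G, p ∈ 2 • Y ∧ q ∈ Y ∧ p - q = f := by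
    intro f
    obtain ⟨p, hp, q, hq, h⟩ := Finset.mem_sub.mp (hF f.2)
    exact ⟨p, q, hp, hq, h⟩
  choose p q hp hq hpq using this
  refine ⟨∑ f, N • q f, fun x hx => ?_⟩
  obtain ⟨m, hm, rfl⟩ := mem_boxSum.mp hx
  have key : ∀ f ∈ (Finset.univ : Finset F), m f • (f : G) + N • q f ∈ (N * 2) • Y := by
    intro f _
    have h1 : m f • (f : G) + N • q f = m f • p f + (N - m f) • q f := by
      rw [← hpq f, smul_sub]
      obtain ⟨k, hk⟩ := Nat.exists_eq_add_of_le (hm f)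
      rw [hk, add_tsub_cancel_left, add_smul]; abel
    rw [h1]
    have h2 := nsmul_mem_nsmul_mul (hp f) (m f)
    have h3 := nsmul_mem_nsmul_mul (Y := Y) (a := q f) (k := 1) (by simpa using hq f) (N - m f)
    have h4 := Finset.add_mem_add h2 h3
    rw [← add_nsmul] at h4
    refine nsmul_subset_nsmul_of_le h0 ?_ h4
    have := hm f
    omega
  have := sum_mem_nsmul Finset.univ _ (fun _ => N * 2) key
  rw [← Finset.sum_add_distrib]
  simpa using this

theorem card_nsmul_le_of_small_doubling {Y : Finset G} (h0 : (0 : G) ∈ Y) {K : ℕ}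
    (hK : (2 • Y).card ≤ K * Y.card) {b : ℕ} (hb : 4 * K ^ 4 ≤ b) (j : ℕ) :
    ((j * b) • Y).card ≤ K * (8 * K ^ 4 * j + 1) ^ K ^ 4 * (b • Y).card := by
  have hY : Y.Nonempty := ⟨0, h0⟩
  have hYpos : 0 < Y.card := hY.card_pos
  have hKpos : 0 < K := by
    rcases Nat.eq_zero_or_pos K with rfl | h
    · have := (hY.nsmul (n := 2)).card_pos
      omega
    · exact h
  have hplu : ((2 • Y - Y + Y).card : ℕ) ≤ K ^ 4 * Y.card := by
    have h1 := Finset.pluennecke_ruzsa_inequality_nsmul_sub_nsmul_add hY Y 3 1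
    have h2 : 2 • Y - Y + Y = 3 • Y - 1 • Y := by
      rw [one_nsmul, show (3 : ℕ) = 2 + 1 from rfl, add_nsmul, one_nsmul, sub_add_eq_add_sub]
    have h3 : ((Y + Y).card : ℚ≥0) / Y.card ≤ K := by
      rw [div_le_iff₀ (by exact_mod_cast hYpos), ← two_nsmul]
      exact_mod_cast hK
    rw [h2]
    have h4 : ((3 • Y - 1 • Y).card : ℚ≥0) ≤ (K : ℚ≥0) ^ 4 * Y.card :=
      h1.trans (by gcongr)
    exact_mod_cast h4
  obtain ⟨F, hFsub, hFcard, hFcov⟩ := Finset.ruzsa_covering_add (K := (K : ℝ) ^ 4)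
    (A := 2 • Y - Y) hY (by exact_mod_cast hplu)
  have hFcard : F.card ≤ K ^ 4 := by exact_mod_cast hFcard
  set D := K ^ 4 with hD
  have hDpos : 0 < D := by positivity
  set N := b / (4 * D) with hN
  have hNpos : 0 < N := Nat.div_pos hb (by positivity)
  have hNb : 4 * D * N ≤ b := Nat.mul_div_le _ _
  have hbN : b ≤ 8 * D * N := by
    have h1 := Nat.lt_div_mul_add (a := b) (b := 4 * D) (by positivity)
    rw [← hN] at h1
    nlinarith
  have h1 : (j * b) • Y ⊆ boxSum F (j * b) + (Y - Y) := by
    refine Finset.Subset.trans ?_ (nsmul_sub_subset_boxSum hFcov (j * b))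
    intro x hx
    exact Finset.mem_sub.mpr ⟨x, nsmul_subset_nsmul_of_le h0 (Nat.le_succ _) hx, 0, h0, sub_zero x⟩
  have h2 : (boxSum F (j * b) + (Y - Y)).card ≤
      (8 * D * j + 1) ^ D * (boxSum F N + (Y - Y)).card := by
    refine (card_boxSum_add_le F (Y - Y) (c := 8 * D * j) hNpos ?_).trans ?_
    · calc j * b ≤ j * (8 * D * N) := by gcongr
        _ = _ := by ring
    · gcongr
      omega
  have h3 : (boxSum F N + (Y - Y)).card ≤ K * (boxSum F N + 2 • Y).card := by
    have h4 := Finset.ruzsa_triangle_inequality_sub_add_add (boxSum F N + Y) Y Y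
    rw [add_sub_assoc, add_assoc, ← two_nsmul] at h4
    have h5 : (boxSum F N + (Y - Y)).card * Y.card ≤ (K * (boxSum F N + 2 • Y).card) * Y.card :=
      h4.trans (by nlinarith)
    exact Nat.le_of_mul_le_mul_right h5 hYpos
  have h6 : (boxSum F N + 2 • Y).card ≤ (b • Y).card := by
    obtain ⟨w, hw⟩ := exists_translate_boxSum h0 hFsub N
    refine Finset.card_le_card_of_injOn (· + w) ?_ (fun x _ y _ h => add_left_injective w h)
    intro x hx
    obtain ⟨p, hp, y, hy, rfl⟩ := Finset.mem_add.mp hx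
    have h7 := Finset.add_mem_add (hw p hp) hy
    rw [← add_nsmul] at h7
    have h8 : F.card * (N * 2) + 2 ≤ b := by
      have : F.card * (N * 2) ≤ D * (N * 2) := by gcongr
      nlinarith
    have h9 := nsmul_subset_nsmul_of_le h0 h8 h7
    have h10 : p + y + w = p + w + y := by abel
    simp only [h10]
    exact_mod_cast h9
  calc ((j * b) • Y).card ≤ (boxSum F (j * b) + (Y - Y)).card := Finset.card_le_card h1
    _ ≤ (8 * D * j + 1) ^ D * (K * (b • Y).card) :=
        h2.trans (by gcongr; exact h3.trans (by gcongr))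
    _ = _ := by ring

end Growth

open scoped Classical in
theorem exists_cosetProg_of_doubling {G : Type} [AddCommGroup G] [Fintype G]
    {X : Finset G} (h0 : (0 : G) ∈ X) {K s b a₀ j κ : ℕ}
    (hK : (2 • (s • X)).card ≤ K * (s • X).card) (hb : 4 * K ^ 4 ≤ b)
    (ha₀ : K * (8 * K ^ 4 * (a₀ + 1) + 1) ^ (K ^ 4) * 18 ^ a₀ < 19 ^ a₀)
    (hj : 2 * (K * (8 * K ^ 4 * ((j + 1) * a₀) + 1) ^ (K ^ 4)) ≤ 4 ^ j)
    (hκ1 : 1 ≤ κ) (hκ : 4 * 4 ^ j ≤ κ) (hw : κ * (3 * κ + 1) ^ κ ≤ s * b) :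
    ∃ (r : ℕ) (H : AddSubgroup G) (Q : GAPData G r), Q.IsSymmetric ∧ IsProperCosetProg H Q ∧
      (X : Set G) ⊆ (H : Set G) + Q.toSet ∧
      (s * b) ^ r * ((H : Set G) + Q.toSet).ncard ≤
        (4 * κ * (3 * κ + 1) ^ κ) ^ κ * κ * ((s * b) • X).card := by
  have hzero : ∀ {Z : Finset G} (n : ℕ), (0 : G) ∈ Z → (0 : G) ∈ n • Z := fun n h => by
    simpa using nsmul_subset_nsmul_of_le h (Nat.zero_le n) (by simp : (0 : G) ∈ 0 • _)
  set Y : Finset G := s • X with hY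
  have hY0 : (0 : G) ∈ Y := hzero s h0
  set W : Finset G := b • Y with hW
  have hW0 : (0 : G) ∈ W := hzero b hY0
  have hWX : W = (s * b) • X := by rw [hW, hY, mul_nsmul]
  have hWpos : 0 < W.card := Finset.card_pos.2 ⟨0, hW0⟩
  have hgrow : ∀ n, (n • W).card ≤ K * (8 * K ^ 4 * n + 1) ^ (K ^ 4) * W.card := by
    intro n
    have := card_nsmul_le_of_small_doubling hY0 hK hb n
    rwa [mul_comm n b, mul_nsmul] at this
  obtain ⟨a, ha1, haa₀, ha⟩ : ∃ a, 1 ≤ a ∧ a ≤ a₀ ∧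
      18 * ((a + 1) • W).card ≤ 19 * (a • W).card := by
    by_contra! hcon
    have key : ∀ n ≤ a₀, 19 ^ n * W.card ≤ 18 ^ n * ((n + 1) • W).card := by
      intro n
      induction n with
      | zero => simp
      | succ n ih =>
        intro hn
        have h1 := ih (by omega)
        have h2 := hcon (n + 1) (by omega) hn
        calc 19 ^ (n + 1) * W.card = 19 * (19 ^ n * W.card) := by ring
          _ ≤ 19 * (18 ^ n * ((n + 1) • W).card) := by gcongr
          _ = 18 ^ n * (19 * ((n + 1) • W).card) := by ring
          _ ≤ 18 ^ n * (18 * ((n + 1 + 1) • W).card) := by gcongr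
          _ = _ := by ring
    have h1 := (key a₀ le_rfl).trans (Nat.mul_le_mul_left _ (hgrow (a₀ + 1)))
    have h2 := Nat.mul_lt_mul_of_pos_right ha₀ hWpos
    refine absurd h1 (not_le.2 (lt_of_eq_of_lt ?_ h2))
    ring
  set A : Finset G := a • W with hA
  have hA0 : (0 : G) ∈ A := hzero a hW0
  have hWA : W.card ≤ A.card := by
    apply Finset.card_le_card
    simpa using nsmul_subset_nsmul_of_le hW0 ha1
  have hjA : 2 * ((j + 1) • A).card ≤ 4 ^ j * W.card := by
    have h1 : (j + 1) • A = ((j + 1) * a) • W := by rw [hA, mul_comm, mul_nsmul]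
    rw [h1]
    calc 2 * (((j + 1) * a) • W).card
        ≤ 2 * (K * (8 * K ^ 4 * ((j + 1) * a) + 1) ^ (K ^ 4) * W.card) := by
          gcongr; exact hgrow _
      _ ≤ 2 * (K * (8 * K ^ 4 * ((j + 1) * a₀) + 1) ^ (K ^ 4) * W.card) := by gcongr
      _ = 2 * (K * (8 * K ^ 4 * ((j + 1) * a₀) + 1) ^ (K ^ 4)) * W.card := by ring
      _ ≤ _ := by gcongr
  have hspec := card_le_card_largeSpectrum A ⟨0, hA0⟩ j (by
    exact_mod_cast hjA.trans (Nat.mul_le_mul_left _ hWA))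
  have hG : (0 : ℝ) < Fintype.card G := by exact_mod_cast Fintype.card_pos
  have hΛ : (0 : ℝ) < (largeSpectrum A).card := by
    rcases (Nat.cast_nonneg (α := ℝ) (largeSpectrum A).card).eq_or_lt with h | h
    · rw [← h, mul_zero] at hspec; linarith
    · exact h
  have hB : {x : G | ∀ χ ∈ largeSpectrum A, 1 / 2 ≤ (χ x).re}.ncard ≤ κ * W.card := by
    have h1 := card_bohr_le (largeSpectrum A)
      (Finset.univ.filter fun x : G => ∀ χ ∈ largeSpectrum A, 1 / 2 ≤ (χ x).re) (by simp)
    rw [Set.ncard_eq_toFinset_card']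
    have h2 : {x : G | ∀ χ ∈ largeSpectrum A, 1 / 2 ≤ (χ x).re}.toFinset =
        Finset.univ.filter fun x : G => ∀ χ ∈ largeSpectrum A, 1 / 2 ≤ (χ x).re := by
      ext; simp
    rw [h2]
    set B := Finset.univ.filter fun x : G => ∀ χ ∈ largeSpectrum A, 1 / 2 ≤ (χ x).re
    have h3 : (B.card : ℝ) ≤ 8 * ((j + 1) • A).card := by
      refine le_of_mul_le_mul_right ?_ hΛ
      linarith
    have h4 : B.card ≤ 8 * ((j + 1) • A).card := by exact_mod_cast h3
    calc B.card ≤ 4 * (2 * ((j + 1) • A).card) := by linarith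
      _ ≤ 4 * (4 ^ j * W.card) := by gcongr
      _ = 4 * 4 ^ j * W.card := by ring
      _ ≤ κ * W.card := by gcongr
  have hdoub : 18 * ((A + W).card : ℝ) ≤ 19 * A.card := by
    have h1 : A + W = (a + 1) • W := by rw [hA, succ_nsmul]
    rw [h1]
    exact_mod_cast ha
  have := exists_cosetProg_of_characters (largeSpectrum A) (X := X) (W := W) hκ1 hw ?_
    (fun y hy χ hχ => abs_arg_le_of_mem_largeSpectrum ⟨0, hA0⟩ hW0 hdoub hχ hy)
    (by rwa [Set.ncard_coe_finset])
  · rw [Set.ncard_coe_finset, hWX] at this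
    exact this
  · intro x hx n hn
    rw [hWX]
    refine nsmul_subset_nsmul_of_le h0 hn ?_
    have h1 := nsmul_mem_nsmul_mul (Y := X) (a := x) (k := 1) (by simpa using hx) n
    simpa using h1

theorem growth_bound_le (d m : ℕ) {n : ℕ} (hn : n ≤ 2 ^ m) :
    2 ^ d * (8 * (2 ^ d) ^ 4 * n + 1) ^ ((2 ^ d) ^ 4) ≤ 2 ^ ((5 * d + m + 4) * 2 ^ (4 * d)) := by
  have h1 : 8 * (2 ^ d) ^ 4 * n + 1 ≤ 2 ^ (4 * d + m + 4) := by
    have h2 : 8 * (2 ^ d) ^ 4 * n ≤ 2 ^ (4 * d + m + 3) := by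
      calc 8 * (2 ^ d) ^ 4 * n ≤ 8 * (2 ^ d) ^ 4 * 2 ^ m := by gcongr
        _ = 2 ^ (4 * d + m + 3) := by ring
    have h3 : 1 ≤ 2 ^ (4 * d + m + 3) := Nat.one_le_two_pow
    rw [show 4 * d + m + 4 = 4 * d + m + 3 + 1 by ring, pow_succ 2 (4 * d + m + 3)]
    omega
  have h4 : (2 ^ d) ^ 4 = 2 ^ (4 * d) := by rw [← pow_mul, mul_comm]
  calc 2 ^ d * (8 * (2 ^ d) ^ 4 * n + 1) ^ ((2 ^ d) ^ 4)
      ≤ 2 ^ d * (2 ^ (4 * d + m + 4)) ^ ((2 ^ d) ^ 4) := by gcongr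
    _ = 2 ^ (d + (4 * d + m + 4) * 2 ^ (4 * d)) := by rw [← pow_mul, ← pow_add, h4]
    _ ≤ 2 ^ ((5 * d + m + 4) * 2 ^ (4 * d)) := by
        apply Nat.pow_le_pow_right (by norm_num)
        have : 1 ≤ 2 ^ (4 * d) := Nat.one_le_two_pow
        nlinarith

theorem two_pow_mul_pow_le (p : ℕ) : 2 ^ p * 18 ^ (18 * p) ≤ 19 ^ (18 * p) := by
  rw [pow_mul, pow_mul, ← mul_pow]
  exact Nat.pow_le_pow_left (by norm_num) p

theorem bohr_constant_le {κ : ℕ} (hκ : 4 ≤ κ) :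
    (4 * κ * (3 * κ + 1) ^ κ) ^ κ * κ ≤ κ ^ κ ^ 3 := by
  have h1 : 4 * κ ≤ κ ^ 2 := by nlinarith
  calc (4 * κ * (3 * κ + 1) ^ κ) ^ κ * κ ≤ (κ ^ 2 * (κ ^ 2) ^ κ) ^ κ * κ := by
        gcongr
        omega
    _ = κ ^ ((2 + 2 * κ) * κ + 1) := by
        rw [← pow_mul, ← pow_add, ← pow_mul, ← pow_succ]
    _ ≤ κ ^ κ ^ 3 := by
        apply Nat.pow_le_pow_right (by omega)
        have : κ ^ 3 = κ * κ * κ := by ring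
        nlinarith

theorem exists_cosetProg_of_two_pow_doubling {G : Type} [AddCommGroup G] [Fintype G]
    [DecidableEq G] {X : Finset G} (h0 : (0 : G) ∈ X) {d s b : ℕ}
    (hK : (2 • (s • X)).card ≤ 2 ^ d * (s • X).card) (hs : 1 ≤ s)
    (hb : 2 ^ 2 ^ 2 ^ (5 * d + 9) ≤ b) :
    ∃ (r : ℕ) (H : AddSubgroup G) (Q : GAPData G r), Q.IsSymmetric ∧ IsProperCosetProg H Q ∧
      (X : Set G) ⊆ (H : Set G) + Q.toSet ∧
      (s * b) ^ r * ((H : Set G) + Q.toSet).ncard ≤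
        2 ^ 2 ^ 2 ^ (5 * d + 9) * ((s * b) • X).card := by
  set p : ℕ := 2 ^ (5 * d + 5) with hp
  set κ : ℕ := 2 ^ (4 * p) with hκdef
  have hd : d + 1 ≤ 2 ^ d := Nat.lt_two_pow_self
  have hp32 : 32 ≤ p := by
    have : 2 ^ 5 ≤ p := Nat.pow_le_pow_right (by norm_num) (by omega)
    simpa using this
  have hpd : p = 32 * 2 ^ d * 2 ^ (4 * d) := by rw [hp]; ring
  have h4d : 1 ≤ 2 ^ (4 * d) := Nat.one_le_two_pow
  have hκ4 : 4 ≤ κ := by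
    have : 2 ^ 2 ≤ κ := Nat.pow_le_pow_right (by norm_num) (by omega)
    simpa using this
  have hconst : κ ^ κ ^ 3 ≤ 2 ^ 2 ^ 2 ^ (5 * d + 9) := by
    have h1 : 4 * p * κ ^ 3 ≤ 2 ^ 2 ^ (5 * d + 9) := by
      calc 4 * p * κ ^ 3 ≤ κ * κ ^ 3 := by gcongr; exact Nat.lt_two_pow_self.le
        _ = 2 ^ (4 * p * 4) := by rw [hκdef, ← pow_mul, ← pow_add]; ring_nf
        _ = 2 ^ 2 ^ (5 * d + 9) := by congr 1; rw [hp]; ring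
    calc κ ^ κ ^ 3 = 2 ^ (4 * p * κ ^ 3) := by rw [hκdef, ← pow_mul]
      _ ≤ _ := Nat.pow_le_pow_right (by norm_num) h1
  have hbohr := (bohr_constant_le hκ4).trans hconst
  have hmain := exists_cosetProg_of_doubling h0 (K := 2 ^ d) (s := s)
    (b := b) (a₀ := 18 * p) (j := p) (κ := κ) (by convert hK) ?_ ?_ ?_ (by omega) ?_ ?_
  · obtain ⟨r, H, Q, h1, h2, h3, h4⟩ := hmain
    refine ⟨r, H, Q, h1, h2, h3, h4.trans ?_⟩
    gcongr
    exact le_of_eq (by congr!)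
  · refine le_trans ?_ hb
    calc 4 * (2 ^ d) ^ 4 = 2 ^ (4 * d + 2) := by ring
      _ ≤ 2 ^ 2 ^ 2 ^ (5 * d + 9) := by
        apply Nat.pow_le_pow_right (by norm_num)
        have a1 : 5 * d + 9 < 2 ^ (5 * d + 9) := Nat.lt_two_pow_self
        have a2 : 2 ^ (5 * d + 9) < 2 ^ 2 ^ (5 * d + 9) := Nat.lt_two_pow_self
        omega
  · refine lt_of_lt_of_le ?_ (two_pow_mul_pow_le p)
    gcongr
    refine (growth_bound_le d (5 * d + 10) ?_).trans_lt ?_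
    · have : (2 : ℕ) ^ (5 * d + 10) = 32 * p := by rw [hp]; ring
      omega
    · apply Nat.pow_lt_pow_right (by norm_num)
      rw [hpd]
      gcongr
      omega
  · calc 2 * (2 ^ d * (8 * (2 ^ d) ^ 4 * ((p + 1) * (18 * p)) + 1) ^ ((2 ^ d) ^ 4))
        ≤ 2 * 2 ^ ((5 * d + (10 * d + 16) + 4) * 2 ^ (4 * d)) := by
          gcongr
          refine growth_bound_le d (10 * d + 16) ?_
          have : (2 : ℕ) ^ (10 * d + 16) = (2 * p) * (32 * p) := by rw [hp]; ring
          rw [this]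
          gcongr <;> omega
      _ = 2 ^ ((5 * d + (10 * d + 16) + 4) * 2 ^ (4 * d) + 1) := by rw [pow_succ]; ring
      _ ≤ 2 ^ (2 * p) := by
          apply Nat.pow_le_pow_right (by norm_num)
          rw [hpd]
          nlinarith
      _ = 4 ^ p := by rw [pow_mul]; norm_num
  · calc 4 * 4 ^ p = 2 ^ (2 * p + 2) := by rw [pow_add, pow_mul]; ring
      _ ≤ κ := Nat.pow_le_pow_right (by norm_num) (by omega)
  · calc κ * (3 * κ + 1) ^ κ ≤ 4 * κ * (3 * κ + 1) ^ κ := by gcongr; omega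
      _ ≤ (4 * κ * (3 * κ + 1) ^ κ) ^ κ * κ := by
        refine (Nat.le_self_pow (by omega) _).trans (Nat.le_mul_of_pos_right _ (by omega))
      _ ≤ b := hbohr.trans hb
      _ ≤ s * b := Nat.le_mul_of_pos_left _ hs

theorem iterSumset_coe {G : Type} [AddCommGroup G] [DecidableEq G] (X : Finset G) (k : ℕ) :
    iterSumset k (X : Set G) = ((k • X : Finset G) : Set G) := by
  induction k with
  | zero => rw [iterSumset, zero_smul, Finset.coe_zero, Set.singleton_zero]
  | succ k ih => rw [iterSumset, ih, succ_nsmul', Finset.coe_add]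

theorem exists_doubling_scale {G : Type} [AddCommGroup G] [DecidableEq G] {X : Finset G}
    (h0 : (0 : G) ∈ X) {d k T M : ℕ} (hd : 0 < d) (hT : 1 ≤ T) (hTM : (2 * T) ^ d ≤ M)
    (h : M * (k • X).card ≤ k ^ d * X.card) :
    ∃ s, 1 ≤ s ∧ T * s ≤ k ∧ (2 • (s • X)).card ≤ 2 ^ d * (s • X).card := by
  have hX : 0 < X.card := Finset.card_pos.2 ⟨0, h0⟩
  have hk : 1 ≤ k := by
    rcases Nat.eq_zero_or_pos k with rfl | hk
    · have hM : 0 < M := lt_of_lt_of_le (by positivity) hTM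
      simp only [zero_smul, Finset.card_zero, mul_one, zero_pow hd.ne', zero_mul] at h
      omega
    · exact hk
  have hle : X.card ≤ (k • X).card := by
    apply Finset.card_le_card
    simpa using nsmul_subset_nsmul_of_le h0 hk
  have hkM : M ≤ k ^ d := Nat.le_of_mul_le_mul_right ((Nat.mul_le_mul_left M hle).trans h) hX
  have hkT : 2 * T ≤ k := (Nat.pow_le_pow_iff_left hd.ne').1 (hTM.trans hkM)
  set l := Nat.log 2 (k / T) with hl
  have hkT0 : k / T ≠ 0 := (Nat.div_pos (by omega) hT).ne'
  have hl1 : T * 2 ^ l ≤ k := by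
    have := Nat.pow_log_le_self 2 hkT0
    calc T * 2 ^ l ≤ T * (k / T) := by gcongr
      _ ≤ k := Nat.mul_div_le _ _
  have hl2 : k < 2 * T * 2 ^ l := by
    have h1 := Nat.lt_pow_succ_log_self (b := 2) (by norm_num) (k / T)
    rw [Nat.div_lt_iff_lt_mul hT] at h1
    calc k < 2 ^ (Nat.log 2 (k / T)).succ * T := h1
      _ = 2 * T * 2 ^ l := by rw [pow_succ]; ring
  by_contra! hcon
  have key : ∀ i ≤ l, 2 ^ (d * i) * X.card ≤ (2 ^ i • X).card := by
    intro i
    induction i with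
    | zero => simp
    | succ i ih =>
      intro hi
      have h1 := ih (by omega)
      have h2 := hcon (2 ^ i) Nat.one_le_two_pow
        ((Nat.mul_le_mul_left T (Nat.pow_le_pow_right (by norm_num) (by omega))).trans hl1)
      rw [← mul_nsmul, ← pow_succ] at h2
      calc 2 ^ (d * (i + 1)) * X.card = 2 ^ d * (2 ^ (d * i) * X.card) := by ring
        _ ≤ 2 ^ d * (2 ^ i • X).card := by gcongr
        _ ≤ _ := h2.le
  have hlk : 2 ^ l ≤ k := (Nat.le_mul_of_pos_left _ hT).trans hl1
  have h3 : 2 ^ (d * l) * X.card ≤ (k • X).card :=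
    (key l le_rfl).trans (Finset.card_le_card (nsmul_subset_nsmul_of_le h0 hlk))
  have h4 : k ^ d < M * 2 ^ (d * l) := by
    calc k ^ d < (2 * T * 2 ^ l) ^ d := Nat.pow_lt_pow_left hl2 hd.ne'
      _ = (2 * T) ^ d * 2 ^ (d * l) := by rw [mul_pow, ← pow_mul, mul_comm l]
      _ ≤ _ := by gcongr
  have h5 : k ^ d * X.card < M * 2 ^ (d * l) * X.card := Nat.mul_lt_mul_of_pos_right h4 hX
  have h6 : M * (2 ^ (d * l) * X.card) ≤ M * (k • X).card := by gcongr
  linarith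

theorem exists_cosetProg_of_growth {G : Type} [AddCommGroup G] [Fintype G] [DecidableEq G]
    {X : Finset G} (h0 : (0 : G) ∈ X) {d k M : ℕ} (hd : 0 < d)
    (hM : (2 * 2 ^ 2 ^ 2 ^ (5 * d + 9)) ^ d ≤ M) (h : M * (k • X).card ≤ k ^ d * X.card) :
    ∃ (r : ℕ) (H : AddSubgroup G) (Q : GAPData G r), r ≤ d ∧ Q.IsSymmetric ∧
      IsProperCosetProg H Q ∧ (X : Set G) ⊆ (H : Set G) + Q.toSet ∧
      k ^ r * ((H : Set G) + Q.toSet).ncard ≤ M * (k • X).card := by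
  set T : ℕ := 2 ^ 2 ^ 2 ^ (5 * d + 9) with hT
  have hT2 : 2 ≤ T := by
    have : 2 ^ 1 ≤ T := Nat.pow_le_pow_right (by norm_num) Nat.one_le_two_pow
    simpa using this
  obtain ⟨s, hs, hsk, hdoub⟩ := exists_doubling_scale h0 hd (by omega) hM h
  have hb : T ≤ k / s := (Nat.le_div_iff_mul_le hs).2 hsk
  obtain ⟨r, H, Q, hsym, hprop, hsub, hcard⟩ :=
    exists_cosetProg_of_two_pow_doubling h0 hdoub hs hb
  set w := s * (k / s) with hw
  have hwk : w ≤ k := Nat.mul_div_le _ _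
  have hkw : k ≤ 2 * w := by
    have h1 := Nat.div_add_mod k s
    have h2 := Nat.mod_lt k hs
    nlinarith
  have hw2 : 2 ≤ w := by nlinarith
  have hX : 0 < X.card := Finset.card_pos.2 ⟨0, h0⟩
  have hXP : X.card ≤ ((H : Set G) + Q.toSet).ncard := by
    rw [← Set.ncard_coe_finset]
    exact Set.ncard_le_ncard hsub (Set.toFinite _)
  have hcard' : w ^ r * ((H : Set G) + Q.toSet).ncard ≤ T * (k • X).card :=
    hcard.trans (Nat.mul_le_mul_left _ (Finset.card_le_card (nsmul_subset_nsmul_of_le h0 hwk)))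
  have hTd : 2 ^ d * T ≤ M := by
    refine le_trans ?_ hM
    rw [mul_pow]
    exact Nat.mul_le_mul_left _ (Nat.le_self_pow hd.ne' _)
  have hr : r ≤ d := by
    have h1 : 2 ^ d * T * (w ^ r * X.card) ≤ 2 ^ d * T * (w ^ d * X.card) := by
      calc 2 ^ d * T * (w ^ r * X.card)
          ≤ 2 ^ d * T * (w ^ r * ((H : Set G) + Q.toSet).ncard) := by gcongr
        _ ≤ 2 ^ d * T * (T * (k • X).card) := by gcongr
        _ = T * (2 ^ d * T * (k • X).card) := by ring
        _ ≤ T * (M * (k • X).card) := by gcongr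
        _ ≤ T * (k ^ d * X.card) := by gcongr
        _ ≤ T * ((2 * w) ^ d * X.card) := by gcongr
        _ = 2 ^ d * T * (w ^ d * X.card) := by rw [mul_pow]; ring
    have h2 := Nat.le_of_mul_le_mul_left h1 (by positivity)
    exact (Nat.pow_le_pow_iff_right hw2).1 (Nat.le_of_mul_le_mul_right h2 hX)
  refine ⟨r, H, Q, hr, hsym, hprop, hsub, ?_⟩
  calc k ^ r * ((H : Set G) + Q.toSet).ncard
      ≤ (2 * w) ^ r * ((H : Set G) + Q.toSet).ncard := by gcongr
    _ = 2 ^ r * (w ^ r * ((H : Set G) + Q.toSet).ncard) := by rw [mul_pow]; ring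
    _ ≤ 2 ^ d * (T * (k • X).card) := by gcongr; norm_num
    _ = 2 ^ d * T * (k • X).card := by ring
    _ ≤ M * (k • X).card := by gcongr

theorem triple_exponential_bound (d : ℕ) :
    (2 * 2 ^ 2 ^ 2 ^ (5 * d + 9)) ^ d ≤ 2 ^ 2 ^ 2 ^ (7 * d + 10) := by
  have h1 : d ≤ 2 ^ d := Nat.lt_two_pow_self.le
  have h2 : 1 ≤ 2 ^ 2 ^ (5 * d + 9) := Nat.one_le_two_pow
  have h3 : 5 * d + 9 < 2 ^ (5 * d + 9) := Nat.lt_two_pow_self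
  rw [← pow_succ', ← pow_mul]
  apply Nat.pow_le_pow_right (by norm_num)
  calc (2 ^ 2 ^ (5 * d + 9) + 1) * d ≤ (2 * 2 ^ 2 ^ (5 * d + 9)) * 2 ^ d := by
        gcongr; omega
    _ = 2 ^ (2 ^ (5 * d + 9) + (d + 1)) := by ring
    _ ≤ 2 ^ 2 ^ (7 * d + 10) := by
        apply Nat.pow_le_pow_right (by norm_num)
        calc 2 ^ (5 * d + 9) + (d + 1) ≤ 2 ^ (5 * d + 10) := by
              rw [pow_succ 2 (5 * d + 9)]; omega
          _ ≤ 2 ^ (7 * d + 10) := Nat.pow_le_pow_right (by norm_num) (by omega)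

theorem stmt16 :
    ∃ C₀ : ℕ, ∀ d : ℕ, 0 < d →
      ∀ (G : Type) [AddCommGroup G] [Fintype G],
        ∀ X : Set G, (0 : G) ∈ X →
          ∀ k : ℕ, 2 ≤ k →
            ((iterSumset k X).ncard : ℝ) ≤
              ((k : ℝ) ^ d / (2 : ℝ) ^ (2 ^ 2 ^ (7 * d + C₀))) * (X.ncard : ℝ) →
            ∃ (r : ℕ) (H : AddSubgroup G) (Q : GAPData G r),
              r ≤ d ∧ Q.IsSymmetric ∧ IsProperCosetProg H Q ∧
              X ⊆ (H : Set G) + Q.toSet ∧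
              (((H : Set G) + Q.toSet).ncard : ℝ) ≤
                ((2 : ℝ) ^ (2 ^ 2 ^ (7 * d + C₀)) / (k : ℝ) ^ r) *
                  ((iterSumset k X).ncard : ℝ) := by
  classical
  refine ⟨10, fun d hd G _ _ X h0 k hk h => ?_⟩
  obtain ⟨X, rfl⟩ := (Set.toFinite X).exists_finset_coe
  rw [iterSumset_coe, Set.ncard_coe_finset] at h ⊢
  rw [Set.ncard_coe_finset, div_mul_eq_mul_div, le_div_iff₀ (by positivity)] at h
  obtain ⟨r, H, Q, hr, hs, hp, hX, hc⟩ := exists_cosetProg_of_growth (k := k)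
    (by simpa using h0) hd (triple_exponential_bound d)
    (X := X) (by rw [mul_comm]; exact_mod_cast h)
  refine ⟨r, H, Q, hr, hs, hp, hX, ?_⟩
  have hk0 : (0 : ℝ) < k := by exact_mod_cast (by omega : 0 < k)
  rw [div_mul_eq_mul_div, le_div_iff₀ (by positivity), mul_comm]
  exact_mod_cast hc
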